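/- Let (W, S) be a finite (spherical) Coxeter system and w ∈ W. If some reduced reflection factorization (t₁, …, t_m) ∈ Red_T(w) generates a parabolic subgroup P of W, then every reduced reflection factorization of w generates P: for all (u₁, …, u_m) ∈ Red_T(w), ⟨u₁, …, u_m⟩ = P. -/

import Mathlib

/-- The reflection length `ℓ_T w` of `w` in a Coxeter system: the least `k` such that
`w` is a product of `k` reflections. -/
noncomputable def reflLen {B W : Type*} [Group W] {M : CoxeterMatrix B}
    (cs : CoxeterSystem M W) (w : W) : ℕ :=
  sInf {k | ∃ l : List W, l.length = k ∧ (∀ t ∈ l, cs.IsReflection t) ∧ l.prod = w}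

/-- `Red_T w`: the set of reduced reflection factorizations of `w`, i.e. tuples of
reflections of length `ℓ_T w` with product `w`. -/
noncomputable def RedT {B W : Type*} [Group W] {M : CoxeterMatrix B}
    (cs : CoxeterSystem M W) (w : W) : Set (List W) :=
  {l | l.length = reflLen cs w ∧ (∀ t ∈ l, cs.IsReflection t) ∧ l.prod = w}

/-- A parabolic subgroup of a Coxeter system: a conjugate `u ⟨S'⟩ u⁻¹` of the subgroup
generated by a subset `S'` of the simple reflections. -/
def IsParabolic {B W : Type*} [Group W] {M : CoxeterMatrix B}
    (cs : CoxeterSystem M W) (P : Subgroup W) : Prop :=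
  ∃ (u : W) (S' : Set B),
    P = (Subgroup.closure (cs.simple '' S')).map (MulAut.conj u).toMonoidHom

section

open Real

/-! ### The root space and its form -/

/-- The sequence `0, 1, c, c² - 1, …` of values of rescaled Chebyshev polynomials of the second
kind: for `c = 2 cos θ` its `k`-th term is `sin (k θ) / sin θ`. -/
noncomputable def chebyshevSeq (c : ℝ) : ℕ → ℝ
  | 0 => 0
  | 1 => 1
  | k + 2 => c * chebyshevSeq c (k + 1) - chebyshevSeq c k

theorem chebyshevSeq_mul_sin (θ : ℝ) (k : ℕ) :
    chebyshevSeq (2 * cos θ) k * sin θ = sin (k * θ) := by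
  induction k using Nat.strong_induction_on with
  | _ k ih =>
    match k with
    | 0 => simp [chebyshevSeq]
    | 1 => simp [chebyshevSeq]
    | k + 2 =>
      have h₁ := ih (k + 1) (by omega)
      have h₀ := ih k (by omega)
      rw [chebyshevSeq, sub_mul, h₀, mul_assoc, h₁]
      push_cast at *
      rw [show ((k : ℝ) + 2) * θ = (k + 1) * θ + θ by ring,
        show (k : ℝ) * θ = (k + 1) * θ - θ by ring, sin_add, sin_sub]
      ring

theorem chebyshevSeq_two (k : ℕ) : chebyshevSeq 2 k = k := by
  induction k using Nat.strong_induction_on with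
  | _ k ih =>
    match k with
    | 0 => simp [chebyshevSeq]
    | 1 => simp [chebyshevSeq]
    | k + 2 =>
      rw [chebyshevSeq, ih (k + 1) (by omega), ih k (by omega)]
      push_cast
      ring

theorem sin_pi_div_nat_pos {m : ℕ} (hm : 2 ≤ m) : 0 < sin (π / m) := by
  have : (2 : ℝ) ≤ m := by exact_mod_cast hm
  apply sin_pos_of_pos_of_lt_pi (by positivity)
  rw [div_lt_iff₀ (by linarith)]
  nlinarith [pi_pos]

theorem chebyshevSeq_nonneg {m k : ℕ} (hm : m ≠ 1) (hk : m ≠ 0 → k ≤ m) :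
    0 ≤ chebyshevSeq (2 * cos (π / m)) k := by
  rcases Nat.eq_zero_or_pos m with rfl | hpos
  · simp [chebyshevSeq_two]
  have hs := sin_pi_div_nat_pos (m := m) (by omega)
  have h := chebyshevSeq_mul_sin (π / m) k
  have hk' : (k : ℝ) ≤ m := by exact_mod_cast hk hpos.ne'
  have hm' : (0 : ℝ) < m := by exact_mod_cast hpos
  have : 0 ≤ sin (k * (π / m)) := by
    apply sin_nonneg_of_nonneg_of_le_pi (by positivity)
    rw [mul_div_assoc', div_le_iff₀ hm']
    nlinarith [pi_pos]
  rw [← h] at this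
  exact nonneg_of_mul_nonneg_left this hs

theorem chebyshevSeq_two_mul {m : ℕ} (hm : 2 ≤ m) :
    chebyshevSeq (2 * cos (π / m)) (2 * m) = 0 ∧
      chebyshevSeq (2 * cos (π / m)) (2 * m + 1) = 1 := by
  have hs := sin_pi_div_nat_pos hm
  have hm' : (m : ℝ) ≠ 0 := by positivity
  constructor
  · apply mul_right_cancel₀ hs.ne'
    rw [chebyshevSeq_mul_sin, zero_mul]
    push_cast
    rw [show 2 * (m : ℝ) * (π / m) = 2 * π by field_simp, sin_two_pi]
  · apply mul_right_cancel₀ hs.ne'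
    rw [chebyshevSeq_mul_sin, one_mul]
    push_cast
    rw [show (2 * (m : ℝ) + 1) * (π / m) = π / m + 2 * π by field_simp; ring, sin_add_two_pi]

namespace CoxeterMatrix

variable {B : Type*} (M : CoxeterMatrix B)

/-- The bilinear form `b` of the geometric representation, normalized so that all roots satisfy
`b γ γ = 2`. -/
noncomputable def form : (B →₀ ℝ) →ₗ[ℝ] (B →₀ ℝ) →ₗ[ℝ] ℝ :=
  Finsupp.linearCombination ℝ fun i ↦ Finsupp.linearCombination ℝ fun j ↦ -(2 * cos (π / M i j))

/-- The simple root indexed by `i`. -/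
noncomputable def simpleRoot {B : Type*} (i : B) : B →₀ ℝ :=
  Finsupp.single i 1

theorem form_simpleRoot (i j : B) :
    M.form (simpleRoot i) (simpleRoot j) = -(2 * cos (π / M i j)) := by
  simp [form, simpleRoot]

theorem form_simpleRoot_self (i : B) : M.form (simpleRoot i) (simpleRoot i) = 2 := by
  simp [form_simpleRoot]

theorem simpleRoot_induction {p : (B →₀ ℝ) → Prop} (x : B →₀ ℝ) (zero : p 0)
    (add : ∀ x y, p x → p y → p (x + y)) (smul : ∀ (r : ℝ) i, p (r • simpleRoot i)) : p x := by
  induction x using Finsupp.induction_linear with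
  | zero => exact zero
  | add x y hx hy => exact add x y hx hy
  | single i r => simpa [simpleRoot] using smul r i

theorem form_comm (x y : B →₀ ℝ) : M.form x y = M.form y x := by
  induction x using simpleRoot_induction with
  | zero => simp
  | add x x' hx hx' => simp [hx, hx']
  | smul r i =>
    induction y using simpleRoot_induction with
    | zero => simp
    | add y y' hy hy' => simp only [map_add, LinearMap.add_apply, hy, hy']
    | smul r' j =>
      simp only [map_smul, LinearMap.smul_apply, form_simpleRoot, M.symmetric i j, smul_eq_mul]
      ring

/-- The reflection `x ↦ x - b x γ • γ`. -/
noncomputable def refl (γ : B →₀ ℝ) : (B →₀ ℝ) →ₗ[ℝ] (B →₀ ℝ) :=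
  LinearMap.id - (M.form.flip γ).smulRight γ

theorem refl_apply (γ x : B →₀ ℝ) : M.refl γ x = x - M.form x γ • γ := rfl

theorem refl_simpleRoot_mul_self (i : B) :
    M.refl (simpleRoot i) * M.refl (simpleRoot i) = 1 := by
  refine LinearMap.ext fun x ↦ ?_
  simp only [Module.End.mul_apply, refl_apply, map_sub, map_smul, form_simpleRoot_self,
    Module.End.one_apply]
  module

theorem refl_mul_refl_pow_apply (i j : B) (k : ℕ) :
    ((M.refl (simpleRoot i) * M.refl (simpleRoot j)) ^ k) (simpleRoot i) =
      chebyshevSeq (2 * cos (π / M i j)) (2 * k + 1) • simpleRoot i +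
        chebyshevSeq (2 * cos (π / M i j)) (2 * k) • simpleRoot j := by
  induction k with
  | zero => simp [chebyshevSeq]
  | succ k ih =>
    rw [pow_succ', Module.End.mul_apply, ih]
    have e : 2 * (k + 1) + 1 = (2 * k + 1) + 2 := by ring
    have e' : 2 * (k + 1) = 2 * k + 2 := by ring
    rw [e, e', chebyshevSeq, show 2 * k + 1 + 1 = 2 * k + 2 by ring, chebyshevSeq]
    simp only [Module.End.mul_apply, refl_apply, map_sub, map_smul, map_add, form_simpleRoot_self]
    rw [M.form_comm (simpleRoot j), form_simpleRoot]
    module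

theorem isLiftable_refl : M.IsLiftable fun i ↦ M.refl (simpleRoot i) := by
  intro i j
  rcases eq_or_ne i j with rfl | hij
  · simp [refl_simpleRoot_mul_self]
  rcases Nat.eq_zero_or_pos (M i j) with h0 | hpos
  · simp [h0]
  have hm : 2 ≤ M i j := by
    have := M.off_diagonal i j hij
    omega
  have fix₁ : ∀ i j, 2 ≤ M i j →
      ((M.refl (simpleRoot i) * M.refl (simpleRoot j)) ^ M i j) (simpleRoot i) =
        simpleRoot i := by
    intro i j hm
    rw [refl_mul_refl_pow_apply, (chebyshevSeq_two_mul hm).1, (chebyshevSeq_two_mul hm).2]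
    simp
  set f := M.refl (simpleRoot i) * M.refl (simpleRoot j) with hf
  set g := M.refl (simpleRoot j) * M.refl (simpleRoot i) with hg
  have hfg : f * g = 1 := by
    rw [hf, hg, mul_assoc, ← mul_assoc (M.refl (simpleRoot j)), refl_simpleRoot_mul_self,
      one_mul, refl_simpleRoot_mul_self]
  have hgf : g * f = 1 := by
    rw [hf, hg, mul_assoc, ← mul_assoc (M.refl (simpleRoot i)), refl_simpleRoot_mul_self,
      one_mul, refl_simpleRoot_mul_self]
  have hpow : f ^ M i j * g ^ M i j = 1 := by
    rw [← (show Commute f g from hfg.trans hgf.symm).mul_pow, hfg, one_pow]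
  have fixi : (f ^ M i j) (simpleRoot i) = simpleRoot i := fix₁ i j hm
  have fixj : (f ^ M i j) (simpleRoot j) = simpleRoot j := by
    have h : (g ^ M i j) (simpleRoot j) = simpleRoot j := by
      have := fix₁ j i (by rwa [M.symmetric])
      rwa [M.symmetric j i] at this
    nth_rw 1 [← h]
    rw [← Module.End.mul_apply, hpow, Module.End.one_apply]
  have fixperp : ∀ x, M.form x (simpleRoot i) = 0 → M.form x (simpleRoot j) = 0 →
      (f ^ M i j) x = x := by
    intro x hi hj
    have hfx : f x = x := by simp [hf, refl_apply, hi, hj]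
    have : ∀ k : ℕ, (f ^ k) x = x := by
      intro k
      induction k with
      | zero => simp
      | succ k ih => rw [pow_succ, Module.End.mul_apply, hfx, ih]
    exact this _
  refine LinearMap.ext fun x ↦ ?_
  have hs := sin_pi_div_nat_pos hm
  have hsc := sin_sq_add_cos_sq (π / M i j)
  set c := cos (π / M i j)
  have hd : 1 - c ^ 2 ≠ 0 := by nlinarith
  set X := M.form x (simpleRoot i)
  set Y := M.form x (simpleRoot j)
  obtain ⟨p, q, hp, hq⟩ : ∃ p q : ℝ, X = 2 * p - 2 * c * q ∧ Y = 2 * q - 2 * c * p := by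
    refine ⟨(X + c * Y) / (2 * (1 - c ^ 2)), (Y + c * X) / (2 * (1 - c ^ 2)), ?_, ?_⟩ <;>
    · field_simp
      ring
  have hx := fixperp (x - p • simpleRoot i - q • simpleRoot j)
    (by
      simp only [map_sub, map_smul, LinearMap.sub_apply, LinearMap.smul_apply,
        form_simpleRoot_self, smul_eq_mul]
      rw [M.form_comm (simpleRoot j), form_simpleRoot]
      linear_combination hp)
    (by
      simp only [map_sub, map_smul, LinearMap.sub_apply, LinearMap.smul_apply,
        form_simpleRoot_self, smul_eq_mul]
      rw [form_simpleRoot]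
      linear_combination hq)
  simp only [map_sub, map_smul, fixi, fixj] at hx
  simpa using hx

end CoxeterMatrix

/-! ### The geometric representation -/

namespace CoxeterSystem

open CoxeterMatrix

variable {B W : Type*} [Group W] {M : CoxeterMatrix B} (cs : CoxeterSystem M W)

/-- The geometric representation of a Coxeter group. -/
noncomputable def geomRep : W →* Module.End ℝ (B →₀ ℝ) :=
  cs.lift ⟨fun i ↦ M.refl (simpleRoot i), M.isLiftable_refl⟩

theorem geomRep_simple (i : B) : cs.geomRep (cs.simple i) = M.refl (simpleRoot i) :=
  cs.lift_apply_simple _ i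

theorem geomRep_simple_apply (i : B) (x : B →₀ ℝ) :
    cs.geomRep (cs.simple i) x = x - M.form x (simpleRoot i) • simpleRoot i := by
  rw [geomRep_simple, refl_apply]

theorem geomRep_mul_apply (v w : W) (x : B →₀ ℝ) :
    cs.geomRep (v * w) x = cs.geomRep v (cs.geomRep w x) := by
  rw [map_mul, Module.End.mul_apply]

theorem geomRep_one_apply (x : B →₀ ℝ) : cs.geomRep 1 x = x := by
  rw [map_one, Module.End.one_apply]

theorem geomRep_inv_apply_self (w : W) (x : B →₀ ℝ) : cs.geomRep w⁻¹ (cs.geomRep w x) = x := by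
  rw [← geomRep_mul_apply, inv_mul_cancel, geomRep_one_apply]

theorem geomRep_apply_inv_self (w : W) (x : B →₀ ℝ) : cs.geomRep w (cs.geomRep w⁻¹ x) = x := by
  rw [← geomRep_mul_apply, mul_inv_cancel, geomRep_one_apply]

theorem form_geomRep (w : W) (x y : B →₀ ℝ) :
    M.form (cs.geomRep w x) (cs.geomRep w y) = M.form x y := by
  induction w using cs.simple_induction_left generalizing x y with
  | one => simp
  | mul_simple_left w i ih =>
    rw [geomRep_mul_apply, geomRep_mul_apply, ← ih x y, geomRep_simple_apply,
      geomRep_simple_apply]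
    simp only [map_sub, map_smul, LinearMap.sub_apply, LinearMap.smul_apply, smul_eq_mul,
      form_simpleRoot_self]
    rw [M.form_comm (simpleRoot i)]
    ring

theorem form_geomRep_left (w : W) (x y : B →₀ ℝ) :
    M.form (cs.geomRep w x) y = M.form x (cs.geomRep w⁻¹ y) := by
  rw [← cs.form_geomRep w x, geomRep_apply_inv_self]

theorem geomRep_simple_simpleRoot (i : B) :
    cs.geomRep (cs.simple i) (simpleRoot i) = -simpleRoot i := by
  rw [geomRep_simple_apply, form_simpleRoot_self]
  module

theorem geomRep_wordProd_alternatingWord (i j : B) (k : ℕ) :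
    cs.geomRep (cs.wordProd (alternatingWord i j k)) (simpleRoot i) =
      if Even k then
        chebyshevSeq (2 * cos (π / M i j)) (k + 1) • simpleRoot i +
          chebyshevSeq (2 * cos (π / M i j)) k • simpleRoot j
      else
        chebyshevSeq (2 * cos (π / M i j)) k • simpleRoot i +
          chebyshevSeq (2 * cos (π / M i j)) (k + 1) • simpleRoot j := by
  induction k with
  | zero => simp [alternatingWord, chebyshevSeq]
  | succ k ih =>
    rw [alternatingWord_succ', wordProd_cons, geomRep_mul_apply, ih, geomRep_simple_apply]
    by_cases hk : Even k
    · have hk' : ¬ Even (k + 1) := by simpa [Nat.even_add_one] using hk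
      simp only [hk, hk', if_true, if_false, map_add, map_smul, LinearMap.add_apply,
        LinearMap.smul_apply, form_simpleRoot_self, form_simpleRoot, chebyshevSeq, smul_eq_mul]
      module
    · have hk' : Even (k + 1) := by simpa [Nat.even_add_one] using hk
      simp only [hk, hk', if_true, if_false, map_add, map_smul, LinearMap.add_apply,
        LinearMap.smul_apply, form_simpleRoot_self, form_simpleRoot, chebyshevSeq, smul_eq_mul,
        M.symmetric j i]
      module

theorem simpleRoot_nonneg (i : B) : (0 : B →₀ ℝ) ≤ simpleRoot i := by
  simp [simpleRoot]

theorem geomRep_wordProd_alternatingWord_nonneg {i j : B} (hij : i ≠ j) {k : ℕ}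
    (hk : M i j ≠ 0 → k < M i j) : ∃ p q : ℝ, 0 ≤ p ∧ 0 ≤ q ∧
      cs.geomRep (cs.wordProd (alternatingWord i j k)) (simpleRoot i) =
        p • simpleRoot i + q • simpleRoot j := by
  have hm := M.off_diagonal i j hij
  have h₀ := chebyshevSeq_nonneg (k := k) hm fun h ↦ (hk h).le
  have h₁ := chebyshevSeq_nonneg (k := k + 1) hm fun h ↦ hk h
  rw [geomRep_wordProd_alternatingWord]
  split_ifs
  · exact ⟨_, _, h₁, h₀, rfl⟩
  · exact ⟨_, _, h₀, h₁, rfl⟩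

theorem length_wordProd_alternatingWord_mul_simple_lt {i j : B} (hM : M i j ≠ 0) :
    cs.length (cs.wordProd (alternatingWord i j (M i j)) * cs.simple i) < M i j := by
  have h : cs.wordProd (alternatingWord i j (M i j)) =
      cs.wordProd (alternatingWord j i (M i j)) := by
    have := cs.wordProd_braidWord_eq i j
    rwa [braidWord, braidWord, M.symmetric j i] at this
  obtain ⟨m, hm⟩ : ∃ m, M i j = m + 1 := Nat.exists_eq_succ_of_ne_zero hM
  rw [h, hm, alternatingWord_succ, wordProd_concat, simple_mul_simple_cancel_right]
  have := cs.length_wordProd_le (alternatingWord i j m)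
  rw [length_alternatingWord] at this
  omega

/-- If `w s_i` is longer than `w`, then `w` is the length-additive product of an element without
right descents at `i` and `j`, and a short alternating word ending in `j`. -/
theorem exists_eq_mul_alternatingWord {w : W} {i j : B}
    (hi : ¬ cs.IsRightDescent w i) : ∃ (v : W) (k : ℕ),
      w = v * cs.wordProd (alternatingWord i j k) ∧ cs.length w = cs.length v + k ∧
      ¬ cs.IsRightDescent v i ∧ ¬ cs.IsRightDescent v j ∧ (M i j ≠ 0 → k < M i j) := by
  classical
  set u : ℕ → W := fun k ↦ cs.wordProd (alternatingWord i j k) with hu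
  have hulen : ∀ k, cs.length (u k) ≤ k := fun k ↦ by
    simpa using cs.length_wordProd_le (alternatingWord i j k)
  have husucc : ∀ k, u (k + 1) = cs.simple (if Even k then j else i) * u k := fun k ↦ by
    simp only [hu, alternatingWord_succ', wordProd_cons]
  have hvsucc : ∀ k, w * (u (k + 1))⁻¹ = w * (u k)⁻¹ * cs.simple (if Even k then j else i) := by
    intro k
    rw [husucc, mul_inv_rev, inv_simple, mul_assoc]
  set P : ℕ → Prop := fun k ↦ cs.length (w * (u k)⁻¹) + k = cs.length w with hP
  have hlow : ∀ k, cs.length w ≤ cs.length (w * (u k)⁻¹) + k := fun k ↦ by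
    have := cs.length_mul_le (w * (u k)⁻¹) (u k)
    rw [inv_mul_cancel_right] at this
    have := hulen k
    omega
  have hP0 : P 0 := by simp [hP, hu, alternatingWord]
  obtain ⟨k, hk, hmax⟩ : ∃ k, P k ∧ ¬ P (k + 1) := by
    by_contra! h
    have hall : ∀ k, P k := fun k ↦ by
      induction k with
      | zero => exact hP0
      | succ k ih => exact h k ih
    have := hall (cs.length w + 1)
    simp only [hP] at this
    omega
  have hnext : ¬ cs.IsRightDescent (w * (u k)⁻¹) (if Even k then j else i) := by
    rw [cs.isRightDescent_iff, ← hvsucc]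
    simp only [hP] at hk hmax
    omega
  have hprev : ¬ cs.IsRightDescent (w * (u k)⁻¹) (if Even k then i else j) := by
    rcases Nat.eq_zero_or_pos k with rfl | hpos
    · simpa [hu, alternatingWord] using hi
    obtain ⟨k, rfl⟩ := Nat.exists_eq_succ_of_ne_zero hpos.ne'
    have hx : (if Even (k + 1) then i else j) = if Even k then j else i := by
      by_cases h : Even k <;> simp [Nat.even_add_one, h]
    rw [Nat.succ_eq_add_one] at hk ⊢
    rw [cs.isRightDescent_iff, hx, hvsucc, simple_mul_simple_cancel_right, ← hvsucc]
    have := hlow k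
    simp only [hP] at hk
    omega
  have hk' : cs.length (w * (u k)⁻¹) + k = cs.length w := hk
  refine ⟨w * (u k)⁻¹, k, by simp [hu], hk'.symm, ?_, ?_, fun hM ↦ ?_⟩
  · by_cases h : Even k <;> simp only [h, if_true, if_false] at hnext hprev <;> assumption
  · by_cases h : Even k <;> simp only [h, if_true, if_false] at hnext hprev <;> assumption
  · by_contra! hle
    rcases hle.eq_or_lt with heq | hlt
    · apply hi
      have h₁ := cs.length_wordProd_alternatingWord_mul_simple_lt hM
      have h₂ := cs.length_mul_le (w * (u k)⁻¹) (u k * cs.simple i)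
      rw [← mul_assoc, inv_mul_cancel_right] at h₂
      rw [heq] at h₁
      unfold IsRightDescent
      simp only [hu] at *
      omega
    · apply cs.not_isReduced_alternatingWord i j hM hlt
      unfold IsReduced
      rw [length_alternatingWord]
      apply le_antisymm (hulen k)
      have := cs.length_mul_le (w * (u k)⁻¹) (u k)
      rw [inv_mul_cancel_right] at this
      simp only [hu] at *
      omega

theorem geomRep_simpleRoot_nonneg {w : W} {i : B} (hi : ¬ cs.IsRightDescent w i) :
    0 ≤ cs.geomRep w (simpleRoot i) := by
  induction hn : cs.length w using Nat.strong_induction_on generalizing w i with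
  | _ n ih =>
    rcases eq_or_ne w 1 with rfl | hw
    · simpa using simpleRoot_nonneg i
    obtain ⟨j, hj⟩ := cs.exists_rightDescent_of_ne_one hw
    have hij : i ≠ j := by rintro rfl; exact hi hj
    obtain ⟨v, k, hwv, hlen, hvi, hvj, hk⟩ := cs.exists_eq_mul_alternatingWord (j := j) hi
    have hkpos : k ≠ 0 := by
      rintro rfl
      apply hvj
      simpa [hwv, alternatingWord] using hj
    obtain ⟨p, q, hp, hq, hpq⟩ := cs.geomRep_wordProd_alternatingWord_nonneg hij hk
    rw [hwv, geomRep_mul_apply, hpq, map_add, map_smul, map_smul]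
    have h₁ := ih (cs.length v) (by omega) hvi rfl
    have h₂ := ih (cs.length v) (by omega) hvj rfl
    exact add_nonneg (smul_nonneg hp h₁) (smul_nonneg hq h₂)

theorem geomRep_simpleRoot_nonpos {w : W} {i : B} (hi : cs.IsRightDescent w i) :
    cs.geomRep w (simpleRoot i) ≤ 0 := by
  have h := cs.geomRep_simpleRoot_nonneg (cs.isRightDescent_iff_not_isRightDescent_mul.mp hi)
  rwa [geomRep_mul_apply, geomRep_simple_simpleRoot, map_neg, neg_nonneg] at h

theorem geomRep_injective : Function.Injective cs.geomRep := by
  rw [injective_iff_map_eq_one]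
  intro w hw
  by_contra hne
  obtain ⟨i, hi⟩ := cs.exists_rightDescent_of_ne_one hne
  have h := cs.geomRep_simpleRoot_nonpos hi
  rw [hw, Module.End.one_apply] at h
  have := h i
  simp [simpleRoot] at this
  linarith

theorem simple_injective' : Function.Injective cs.simple := by
  intro i j hij
  by_contra hne
  have h : cs.geomRep (cs.simple i) (simpleRoot i) = cs.geomRep (cs.simple j) (simpleRoot i) := by
    rw [hij]
  rw [geomRep_simple_simpleRoot, geomRep_simple_apply] at h
  have := DFunLike.congr_fun h i
  simp [simpleRoot, Ne.symm hne] at this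
  linarith

end CoxeterSystem

/-! ### Positive definiteness of the form -/

namespace CoxeterSystem

open CoxeterMatrix

variable {B W : Type*} [Group W] {M : CoxeterMatrix B} (cs : CoxeterSystem M W)

theorem finite_index [Finite W] (cs : CoxeterSystem M W) : Finite B :=
  Finite.of_injective _ cs.simple_injective'

/-- A finite Coxeter group admits an invariant inner product. -/
theorem exists_invariant_form [Finite W] : ∃ q : (B →₀ ℝ) →ₗ[ℝ] (B →₀ ℝ) →ₗ[ℝ] ℝ,
    (∀ w x y, q (cs.geomRep w x) (cs.geomRep w y) = q x y) ∧ (∀ x y, q x y = q y x) ∧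
      ∀ x, x ≠ 0 → 0 < q x x := by
  have := Fintype.ofFinite W
  have := cs.finite_index
  have := Fintype.ofFinite B
  set dot : (B →₀ ℝ) →ₗ[ℝ] (B →₀ ℝ) →ₗ[ℝ] ℝ := Finsupp.linearCombination ℝ Finsupp.lapply
    with hdot
  have hdot_apply : ∀ x y, dot x y = ∑ i, x i * y i := fun x y ↦ by
    simp [hdot, Finsupp.linearCombination_apply, Finsupp.sum_fintype]
  have hq : ∀ x y, (∑ w : W, dot.compl₁₂ (cs.geomRep w) (cs.geomRep w)) x y =
      ∑ w : W, dot (cs.geomRep w x) (cs.geomRep w y) := fun x y ↦ by simp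
  refine ⟨∑ w : W, dot.compl₁₂ (cs.geomRep w) (cs.geomRep w), fun w x y ↦ ?_, fun x y ↦ ?_,
    fun x hx ↦ ?_⟩
  · rw [hq, hq]
    refine Fintype.sum_equiv (Equiv.mulRight w) _ _ fun v ↦ ?_
    simp only [Equiv.coe_mulRight, geomRep_mul_apply]
  · simp only [hq, hdot_apply, mul_comm]
  · rw [hq]
    refine Finset.sum_pos' (fun w _ ↦ ?_) ⟨1, Finset.mem_univ _, ?_⟩
    · rw [hdot_apply]
      exact Finset.sum_nonneg fun i _ ↦ mul_self_nonneg _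
    · obtain ⟨i, hi⟩ := Finsupp.ne_iff.mp hx
      rw [geomRep_one_apply, hdot_apply]
      exact Finset.sum_pos' (fun i _ ↦ mul_self_nonneg _)
        ⟨i, Finset.mem_univ _, mul_self_pos.mpr (by simpa using hi)⟩

theorem form_self_pos [Finite W] (cs : CoxeterSystem M W) {x : B →₀ ℝ} (hx : x ≠ 0) :
    0 < M.form x x := by
  obtain ⟨q, hinv, hsymm, hpos⟩ := cs.exists_invariant_form
  have hqi : ∀ i : B, 0 < q (simpleRoot i) (simpleRoot i) := fun i ↦
    hpos _ (by simp [simpleRoot])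
  have hq : ∀ x i, 2 * q x (simpleRoot i) =
      M.form x (simpleRoot i) * q (simpleRoot i) (simpleRoot i) := fun x i ↦ by
    have := hinv (cs.simple i) x (simpleRoot i)
    rw [geomRep_simple_simpleRoot, geomRep_simple_apply] at this
    simp only [map_sub, map_smul, LinearMap.sub_apply, LinearMap.smul_apply, smul_eq_mul,
      map_neg] at this
    linarith
  set d : B → ℝ := fun i ↦ √(2 / q (simpleRoot i) (simpleRoot i)) with hd
  have hdpos : ∀ i, 0 < d i := fun i ↦ sqrt_pos.mpr (div_pos two_pos (hqi i))
  set D : (B →₀ ℝ) →ₗ[ℝ] (B →₀ ℝ) := Finsupp.linearCombination ℝ fun i ↦ d i • simpleRoot i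
    with hD
  have hDroot : ∀ i, D (simpleRoot i) = d i • simpleRoot i := fun i ↦ by simp [hD, simpleRoot]
  have hDapply : ∀ x i, D x i = d i * x i := fun x i ↦ by
    induction x using simpleRoot_induction with
    | zero => simp
    | add x y hx hy => simp [hx, hy, mul_add]
    | smul r j =>
      rw [map_smul, hDroot]
      rcases eq_or_ne j i with rfl | hji
      · simp [simpleRoot, mul_comm]
      · simp [simpleRoot, hji]
  have hform : ∀ x y, M.form x y = q (D x) (D y) := fun x y ↦ by
    induction x using simpleRoot_induction with
    | zero => simp
    | add x x' hx hx' => simp [hx, hx']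
    | smul r i =>
      induction y using simpleRoot_induction with
      | zero => simp
      | add y y' hy hy' => simp only [map_add, hy, hy']
      | smul r' j =>
        simp only [map_smul, LinearMap.smul_apply, hDroot, smul_eq_mul]
        have h₁ := hq (simpleRoot i) j
        have h₂ := hq (simpleRoot j) i
        rw [hsymm, M.form_comm] at h₂
        have h₃ : M.form (simpleRoot i) (simpleRoot j) =
            d i * (d j * q (simpleRoot i) (simpleRoot j)) := by
          rcases eq_or_ne (M.form (simpleRoot i) (simpleRoot j)) 0 with h0 | h0
          · have : q (simpleRoot i) (simpleRoot j) = 0 := by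
              rw [h0] at h₁
              linarith
            rw [h0, this]
            ring
          · have hij : q (simpleRoot i) (simpleRoot i) = q (simpleRoot j) (simpleRoot j) :=
              mul_left_cancel₀ h0 (h₂.symm.trans h₁)
            have hdd : d i * d j = 2 / q (simpleRoot j) (simpleRoot j) := by
              simp only [hd, hij]
              exact mul_self_sqrt (div_pos two_pos (hqi j)).le
            rw [← mul_assoc, hdd]
            have := (hqi j).ne'
            field_simp
            linarith
        rw [h₃]
        ring
  rw [hform]
  refine hpos _ fun h ↦ hx (Finsupp.ext fun i ↦ ?_)
  have := DFunLike.congr_fun h i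
  rw [hDapply] at this
  simpa [(hdpos i).ne'] using this

theorem eq_zero_of_form_self [Finite W] (cs : CoxeterSystem M W) {x : B →₀ ℝ}
    (hx : M.form x x = 0) : x = 0 := by
  by_contra h
  exact (cs.form_self_pos h).ne' hx

/-- Every functional is represented by the form. -/
theorem exists_form_eq [Finite W] (cs : CoxeterSystem M W) (f : (B →₀ ℝ) →ₗ[ℝ] ℝ) :
    ∃ z, M.form z = f := by
  have := cs.finite_index
  have hinj : Function.Injective M.form := by
    rw [← LinearMap.ker_eq_bot, LinearMap.ker_eq_bot']
    intro x hx
    exact cs.eq_zero_of_form_self (by rw [hx, LinearMap.zero_apply])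
  have : Function.Surjective M.form :=
    (LinearMap.injective_iff_surjective_of_finrank_eq_finrank
      (by rw [Subspace.dual_finrank_eq (K := ℝ) (V := B →₀ ℝ)] )).mp hinj
  exact this f

theorem exists_form_simpleRoot_eq [Finite W] (cs : CoxeterSystem M W) (f : B → ℝ) :
    ∃ z, ∀ i, M.form z (simpleRoot i) = f i := by
  obtain ⟨z, hz⟩ := cs.exists_form_eq (Finsupp.linearCombination ℝ f)
  exact ⟨z, fun i ↦ by rw [hz]; simp [simpleRoot]⟩

theorem exists_form_eq_of_notMem [Finite W] (cs : CoxeterSystem M W) {N : Submodule ℝ (B →₀ ℝ)}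
    {x : B →₀ ℝ} (hx : x ∉ N) : ∃ z, M.form z x ≠ 0 ∧ ∀ y ∈ N, M.form z y = 0 := by
  obtain ⟨f, hf, hN⟩ := Submodule.exists_dual_map_eq_bot_of_notMem hx inferInstance
  obtain ⟨z, rfl⟩ := cs.exists_form_eq f
  refine ⟨z, hf, fun y hy ↦ ?_⟩
  have : M.form z y ∈ N.map (M.form z) := Submodule.mem_map_of_mem hy
  simpa [hN] using this

end CoxeterSystem

/-! ### Roots -/

namespace CoxeterSystem

open CoxeterMatrix

variable {B W : Type*} [Group W] {M : CoxeterMatrix B} (cs : CoxeterSystem M W)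

/-- `γ` is one of the two roots attached to the reflection `t`. -/
def HasRoot (t : W) (γ : B →₀ ℝ) : Prop :=
  ∃ w i, t = w * cs.simple i * w⁻¹ ∧ γ = cs.geomRep w (simpleRoot i)

theorem hasRoot_simple (i : B) : cs.HasRoot (cs.simple i) (simpleRoot i) :=
  ⟨1, i, by simp, by simp⟩

variable {cs}

theorem IsReflection.exists_hasRoot {t : W} (ht : cs.IsReflection t) : ∃ γ, cs.HasRoot t γ := by
  obtain ⟨w, i, rfl⟩ := ht
  exact ⟨_, w, i, rfl, rfl⟩

namespace HasRoot

variable {t u : W} {γ δ : B →₀ ℝ}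

theorem isReflection (h : cs.HasRoot t γ) : cs.IsReflection t := by
  obtain ⟨w, i, rfl, -⟩ := h
  exact ⟨w, i, rfl⟩

theorem geomRep_apply (h : cs.HasRoot t γ) (x : B →₀ ℝ) :
    cs.geomRep t x = x - M.form x γ • γ := by
  obtain ⟨w, i, rfl, rfl⟩ := h
  rw [geomRep_mul_apply, geomRep_mul_apply, geomRep_simple_apply, map_sub, map_smul,
    geomRep_apply_inv_self, form_geomRep_left, inv_inv]

theorem form_self (h : cs.HasRoot t γ) : M.form γ γ = 2 := by
  obtain ⟨w, i, rfl, rfl⟩ := h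
  rw [form_geomRep, form_simpleRoot_self]

theorem ne_zero (h : cs.HasRoot t γ) : γ ≠ 0 := by
  rintro rfl
  simpa using h.form_self

theorem geomRep_apply_self (h : cs.HasRoot t γ) : cs.geomRep t γ = -γ := by
  rw [h.geomRep_apply, h.form_self]
  module

theorem conj (h : cs.HasRoot t γ) (g : W) : cs.HasRoot (g * t * g⁻¹) (cs.geomRep g γ) := by
  obtain ⟨w, i, rfl, rfl⟩ := h
  exact ⟨g * w, i, by group, by rw [geomRep_mul_apply]⟩

theorem neg (h : cs.HasRoot t γ) : cs.HasRoot t (-γ) := by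
  simpa [h.geomRep_apply_self] using h.conj t

theorem mul_self (h : cs.HasRoot t γ) : t * t = 1 := h.isReflection.mul_self

theorem inv (h : cs.HasRoot t γ) : t⁻¹ = t := h.isReflection.inv

theorem unique (h : cs.HasRoot t γ) (h' : cs.HasRoot u γ) : t = u :=
  cs.geomRep_injective (LinearMap.ext fun x ↦ by rw [h.geomRep_apply, h'.geomRep_apply])

theorem eq_or_eq_neg (h : cs.HasRoot t γ) (h' : cs.HasRoot t δ) : δ = γ ∨ δ = -γ := by
  have h₁ := h.geomRep_apply δ
  rw [h'.geomRep_apply_self] at h₁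
  have h₂ : δ = (M.form δ γ / 2) • γ := by
    have : (2 : ℝ) • δ = M.form δ γ • γ := by
      rw [eq_sub_iff_add_eq, neg_add_eq_iff_eq_add] at h₁
      rw [two_smul, h₁]
    rw [div_eq_inv_mul, mul_smul, ← this, smul_smul]
    norm_num
  have h₃ := h'.form_self
  set c := M.form δ γ / 2
  rw [h₂] at h₃
  simp only [map_smul, LinearMap.smul_apply, h.form_self, smul_eq_mul] at h₃
  have h₄ : (c - 1) * (c + 1) = 0 := by linarith
  rcases mul_eq_zero.mp h₄ with h₅ | h₅
  · left
    rw [h₂, sub_eq_zero.mp h₅, one_smul]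
  · right
    rw [h₂, eq_neg_of_add_eq_zero_left h₅, neg_one_smul]

theorem nonneg_or_nonpos (h : cs.HasRoot t γ) : 0 ≤ γ ∨ γ ≤ 0 := by
  obtain ⟨w, i, rfl, rfl⟩ := h
  by_cases hi : cs.IsRightDescent w i
  · exact .inr (cs.geomRep_simpleRoot_nonpos hi)
  · exact .inl (cs.geomRep_simpleRoot_nonneg hi)

end HasRoot

theorem finite_setOf_hasRoot [Finite W] : {γ | ∃ t, cs.HasRoot t γ}.Finite := by
  have := cs.finite_index
  refine (Set.finite_range fun p : W × B ↦ cs.geomRep p.1 (simpleRoot p.2)).subset ?_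
  rintro γ ⟨t, w, i, -, rfl⟩
  exact ⟨(w, i), rfl⟩

variable (cs) in
/-- The subgroup generated by the simple reflections indexed by `S`. -/
def standardParabolic (S : Set B) : Subgroup W := Subgroup.closure (cs.simple '' S)

theorem simple_mem_standardParabolic {S : Set B} {i : B} (hi : i ∈ S) :
    cs.simple i ∈ cs.standardParabolic S :=
  Subgroup.subset_closure ⟨i, hi, rfl⟩

theorem simpleRoot_mem_supported {S : Set B} {i : B} (hi : i ∈ S) :
    simpleRoot i ∈ Finsupp.supported ℝ ℝ S :=
  Finsupp.single_mem_supported ℝ 1 hi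

/-- The submodule `N` contains a root of `t`. -/
theorem geomRep_sub_mem {N : Submodule ℝ (B →₀ ℝ)} {T : Set W}
    (hT : ∀ t ∈ T, ∃ γ ∈ N, cs.HasRoot t γ) {g : W} (hg : g ∈ Subgroup.closure T)
    (x : B →₀ ℝ) : cs.geomRep g x - x ∈ N := by
  induction hg using Subgroup.closure_induction generalizing x with
  | mem t ht =>
    obtain ⟨γ, hγ, h⟩ := hT t ht
    rw [h.geomRep_apply, sub_sub_cancel_left]
    exact N.neg_mem (N.smul_mem _ hγ)
  | one => simp
  | mul g h _ _ ihg ihh =>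
    rw [geomRep_mul_apply, ← sub_add_sub_cancel _ (cs.geomRep h x)]
    exact N.add_mem (ihg _) (ihh _)
  | inv g _ ih =>
    have := N.neg_mem (ih (cs.geomRep g⁻¹ x))
    rwa [geomRep_apply_inv_self, neg_sub] at this

theorem geomRep_mem {N : Submodule ℝ (B →₀ ℝ)} {T : Set W}
    (hT : ∀ t ∈ T, ∃ γ ∈ N, cs.HasRoot t γ) {g : W} (hg : g ∈ Subgroup.closure T)
    {x : B →₀ ℝ} (hx : x ∈ N) : cs.geomRep g x ∈ N := by
  simpa using N.add_mem (geomRep_sub_mem hT hg x) hx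

theorem geomRep_eq_self_of_orthogonal {T : Set W} {x : B →₀ ℝ}
    (hT : ∀ t ∈ T, ∃ γ, M.form x γ = 0 ∧ cs.HasRoot t γ) {g : W}
    (hg : g ∈ Subgroup.closure T) : cs.geomRep g x = x := by
  induction hg using Subgroup.closure_induction with
  | mem t ht =>
    obtain ⟨γ, hγ, h⟩ := hT t ht
    rw [h.geomRep_apply, hγ, zero_smul, sub_zero]
  | one => simp
  | mul g h _ _ ihg ihh => rw [geomRep_mul_apply, ihh, ihg]
  | inv g _ ih =>
    nth_rw 1 [← ih]
    rw [geomRep_inv_apply_self]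

theorem exists_hasRoot_supported (S : Set B) :
    ∀ t ∈ cs.simple '' S, ∃ γ ∈ Finsupp.supported ℝ ℝ S, cs.HasRoot t γ := by
  rintro _ ⟨i, hi, rfl⟩
  exact ⟨_, simpleRoot_mem_supported hi, cs.hasRoot_simple i⟩

theorem geomRep_mem_supported {S : Set B} {g : W} (hg : g ∈ cs.standardParabolic S)
    {x : B →₀ ℝ} (hx : x ∈ Finsupp.supported ℝ ℝ S) :
    cs.geomRep g x ∈ Finsupp.supported ℝ ℝ S :=
  geomRep_mem (exists_hasRoot_supported S) hg hx

theorem form_apply_eq_sum (v x : B →₀ ℝ) :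
    M.form v x = x.sum fun i r ↦ r * M.form v (simpleRoot i) := by
  conv_lhs => rw [← Finsupp.sum_single x]
  rw [Finsupp.sum, map_sum, Finsupp.sum]
  refine Finset.sum_congr rfl fun i _ ↦ ?_
  rw [← smul_eq_mul, ← map_smul, simpleRoot, Finsupp.smul_single, smul_eq_mul, mul_one]

theorem form_nonneg {v x : B →₀ ℝ} {S : Set B} (hv : ∀ i ∈ S, 0 ≤ M.form v (simpleRoot i))
    (hx : x ∈ Finsupp.supported ℝ ℝ S) (hx0 : 0 ≤ x) : 0 ≤ M.form v x := by
  rw [form_apply_eq_sum]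
  exact Finset.sum_nonneg fun i hi ↦ mul_nonneg (hx0 i) (hv i (hx hi))

/-- A nonnegative vector orthogonal to a dominant vector `v` is supported on the walls
containing `v`. -/
theorem mem_supported_of_form_eq_zero {v x : B →₀ ℝ} {S : Set B}
    (hv : ∀ i ∈ S, 0 ≤ M.form v (simpleRoot i)) (hx : x ∈ Finsupp.supported ℝ ℝ S) (hx0 : 0 ≤ x)
    (h : M.form v x = 0) :
    x ∈ Finsupp.supported ℝ ℝ {i ∈ S | M.form v (simpleRoot i) = 0} := by
  rw [form_apply_eq_sum, Finsupp.sum,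
    Finset.sum_eq_zero_iff_of_nonneg fun i hi ↦ mul_nonneg (hx0 i) (hv i (hx hi))] at h
  intro i hi
  have := h i hi
  exact ⟨hx hi, by simpa [Finsupp.mem_support_iff.mp hi] using this⟩

theorem HasRoot.mem_supported_of_form_eq_zero {t : W} {v γ : B →₀ ℝ} {S : Set B}
    (h : cs.HasRoot t γ) (hv : ∀ i ∈ S, 0 ≤ M.form v (simpleRoot i))
    (hγ : γ ∈ Finsupp.supported ℝ ℝ S) (h0 : M.form v γ = 0) :
    γ ∈ Finsupp.supported ℝ ℝ {i ∈ S | M.form v (simpleRoot i) = 0} := by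
  rcases h.nonneg_or_nonpos with hγ0 | hγ0
  · exact CoxeterSystem.mem_supported_of_form_eq_zero hv hγ hγ0 h0
  · rw [← Submodule.neg_mem_iff]
    refine CoxeterSystem.mem_supported_of_form_eq_zero hv (Submodule.neg_mem _ hγ)
      (neg_nonneg.mpr hγ0) ?_
    rw [map_neg, h0, neg_zero]

variable (cs) in
/-- Every vector can be moved into the fundamental chamber of a standard parabolic subgroup. -/
theorem exists_dominant [Finite W] (S : Set B) (v : B →₀ ℝ) :
    ∃ g ∈ cs.standardParabolic S, ∀ i ∈ S, 0 ≤ M.form (cs.geomRep g v) (simpleRoot i) := by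
  obtain ⟨z, hz⟩ := cs.exists_form_simpleRoot_eq fun _ ↦ 1
  obtain ⟨⟨g, hg⟩, hmax⟩ := Finite.exists_max
    fun g : cs.standardParabolic S ↦ M.form z (cs.geomRep g v)
  refine ⟨g, hg, fun i hi ↦ ?_⟩
  have := hmax ⟨cs.simple i * g, mul_mem (simple_mem_standardParabolic hi) hg⟩
  simp only [geomRep_mul_apply, geomRep_simple_apply, map_sub, map_smul, hz, smul_eq_mul] at this
  linarith

/-- The stabilizer of a vector in the fundamental chamber is a standard parabolic subgroup. -/
theorem mem_standardParabolic_of_geomRep_eq {v : B →₀ ℝ}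
    (hv : ∀ i, 0 ≤ M.form v (simpleRoot i)) {h : W} (hh : cs.geomRep h v = v) :
    h ∈ cs.standardParabolic {i | M.form v (simpleRoot i) = 0} := by
  induction hn : cs.length h using Nat.strong_induction_on generalizing h with
  | _ n ih =>
    rcases eq_or_ne h 1 with rfl | hne
    · exact one_mem _
    obtain ⟨i, hi⟩ := cs.exists_rightDescent_of_ne_one hne
    have h₁ : M.form v (simpleRoot i) ≤ 0 := by
      rw [← cs.form_geomRep h, hh, ← neg_nonneg, ← map_neg]
      exact form_nonneg (S := Set.univ) (fun i _ ↦ hv i) (by simp)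
        (neg_nonneg.mpr (cs.geomRep_simpleRoot_nonpos hi))
    have h₂ : M.form v (simpleRoot i) = 0 := le_antisymm h₁ (hv i)
    have h₃ := ih _ (hn ▸ hi) (h := h * cs.simple i)
      (by rw [geomRep_mul_apply, geomRep_simple_apply, h₂, zero_smul, sub_zero, hh]) rfl
    rw [← mul_inv_cancel_right h (cs.simple i), cs.inv_simple]
    exact mul_mem h₃ (simple_mem_standardParabolic h₂)

variable (cs) in
/-- A submodule contains a vector that is orthogonal only to those roots that are orthogonal to
the whole submodule. -/
theorem exists_generic [Finite W] (N : Submodule ℝ (B →₀ ℝ)) :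
    ∃ v ∈ N, ∀ t γ, cs.HasRoot t γ → M.form v γ = 0 → ∀ x ∈ N, M.form x γ = 0 := by
  set s : Set (B →₀ ℝ) := {γ | (∃ t, cs.HasRoot t γ) ∧ ∃ x ∈ N, M.form x γ ≠ 0} with hs
  have : Finite s := (finite_setOf_hasRoot (cs := cs)).subset fun γ hγ ↦ hγ.1
  obtain ⟨v, hv, h⟩ := Module.Dual.exists_forall_mem_ne_zero_of_forall_exists N
    (fun γ : s ↦ M.form γ.1) fun ⟨γ, _, x, hx, hxγ⟩ ↦ ⟨x, hx, by rwa [M.form_comm]⟩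
  refine ⟨v, hv, fun t γ ht h0 x hx ↦ ?_⟩
  by_contra hne
  exact h ⟨γ, ⟨t, ht⟩, x, hx, hne⟩ (by rwa [M.form_comm])

/-- Steinberg's fixed point theorem. -/
theorem exists_hasRoot_orthogonal_fixed [Finite W] {w : W} (hw : w ≠ 1) :
    ∃ t γ, cs.HasRoot t γ ∧ ∀ x, cs.geomRep w x = x → M.form x γ = 0 := by
  obtain ⟨v, hv, hgen⟩ := cs.exists_generic (LinearMap.eqLocus (cs.geomRep w) LinearMap.id)
  obtain ⟨g, -, hg⟩ := cs.exists_dominant Set.univ v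
  have hfix : cs.geomRep (g * w * g⁻¹) (cs.geomRep g v) = cs.geomRep g v := by
    rw [geomRep_mul_apply, geomRep_mul_apply, geomRep_inv_apply_self]
    exact congrArg _ hv
  have hmem := mem_standardParabolic_of_geomRep_eq (fun i ↦ hg i trivial) hfix
  obtain ⟨i, hi⟩ : {i | M.form (cs.geomRep g v) (simpleRoot i) = 0}.Nonempty := by
    by_contra hempty
    rw [Set.not_nonempty_iff_eq_empty.mp hempty, standardParabolic, Set.image_empty,
      Subgroup.closure_empty, Subgroup.mem_bot, conj_eq_one_iff] at hmem
    exact hw hmem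
  refine ⟨_, _, (cs.hasRoot_simple i).conj g⁻¹, fun x hx ↦ ?_⟩
  refine hgen _ _ ((cs.hasRoot_simple i).conj g⁻¹) ?_ x hx
  rw [← form_geomRep_left]
  exact hi

/-- A reflection whose root is supported on `S` belongs to the standard parabolic subgroup. -/
theorem HasRoot.mem_standardParabolic [Finite W] {t : W} {γ : B →₀ ℝ} (h : cs.HasRoot t γ)
    {S : Set B} (hγ : γ ∈ Finsupp.supported ℝ ℝ S) : t ∈ cs.standardParabolic S := by
  classical
  obtain ⟨v, hv⟩ := cs.exists_form_simpleRoot_eq fun i ↦ if i ∈ S then 0 else 1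
  have hvγ : M.form v γ = 0 := by
    rw [form_apply_eq_sum]
    exact Finset.sum_eq_zero fun i hi ↦ by simp [hv, hγ hi]
  have := mem_standardParabolic_of_geomRep_eq (cs := cs) (v := v) (h := t)
    (fun i ↦ by rw [hv]; split_ifs <;> norm_num)
    (by rw [h.geomRep_apply, hvγ, zero_smul, sub_zero])
  convert this using 2
  ext i
  simp [hv]

end CoxeterSystem

/-! ### Reflection factorizations -/

namespace CoxeterSystem

open CoxeterMatrix Module

variable {B W : Type*} [Group W] {M : CoxeterMatrix B} {cs : CoxeterSystem M W}

variable (cs) in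
/-- The moved space of `w`. -/
noncomputable def movedSpace (w : W) : Submodule ℝ (B →₀ ℝ) :=
  LinearMap.range (cs.geomRep w - 1)

theorem mem_movedSpace_of_orthogonal [Finite W] {w : W} {γ : B →₀ ℝ}
    (hγ : ∀ x, cs.geomRep w x = x → M.form x γ = 0) : γ ∈ cs.movedSpace w := by
  by_contra h
  obtain ⟨z, hz, hzw⟩ := cs.exists_form_eq_of_notMem h
  refine hz (hγ z ?_)
  have h₁ : ∀ x, M.form (cs.geomRep w⁻¹ z - z) x = 0 := fun x ↦ by
    have := hzw _ ⟨x, rfl⟩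
    rwa [LinearMap.sub_apply, Module.End.one_apply, map_sub, ← inv_inv w, ← form_geomRep_left,
      ← LinearMap.sub_apply, ← map_sub] at this
  have h₂ := sub_eq_zero.mp (cs.eq_zero_of_form_self (h₁ _))
  rw [← h₂, geomRep_apply_inv_self, h₂]

theorem finrank_movedSpace_mul_lt [Finite W] {t w : W} {γ : B →₀ ℝ} (ht : cs.HasRoot t γ)
    (hγ : ∀ x, cs.geomRep w x = x → M.form x γ = 0) :
    finrank ℝ (cs.movedSpace (t * w)) < finrank ℝ (cs.movedSpace w) := by
  have := cs.finite_index
  obtain ⟨x, hx⟩ := mem_movedSpace_of_orthogonal (cs := cs) hγ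
  rw [LinearMap.sub_apply, Module.End.one_apply, sub_eq_iff_eq_add] at hx
  have hlt : LinearMap.ker (cs.geomRep w - 1) < LinearMap.ker (cs.geomRep (t * w) - 1) := by
    refine SetLike.lt_iff_le_and_exists.mpr ⟨fun y hy ↦ ?_, x, ?_, ?_⟩
    · rw [LinearMap.mem_ker, LinearMap.sub_apply, Module.End.one_apply, sub_eq_zero] at hy ⊢
      rw [geomRep_mul_apply, ht.geomRep_apply, hy, hγ y hy, zero_smul, sub_zero]
    · have h₁ := cs.form_geomRep w x x
      rw [hx] at h₁
      simp only [map_add, LinearMap.add_apply, ht.form_self, M.form_comm γ x] at h₁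
      have h₂ : M.form x γ = -1 := by linarith
      rw [LinearMap.mem_ker, LinearMap.sub_apply, Module.End.one_apply, sub_eq_zero,
        geomRep_mul_apply, hx, ht.geomRep_apply, map_add, LinearMap.add_apply, ht.form_self, h₂]
      module
    · rw [LinearMap.mem_ker, LinearMap.sub_apply, Module.End.one_apply, hx, add_sub_cancel_right]
      exact ht.ne_zero
  have h₁ := Submodule.finrank_lt_finrank_of_lt hlt
  have h₂ : finrank ℝ (cs.movedSpace w) + _ = _ :=
    LinearMap.finrank_range_add_finrank_ker (cs.geomRep w - 1)
  have h₃ : finrank ℝ (cs.movedSpace (t * w)) + _ = _ :=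
    LinearMap.finrank_range_add_finrank_ker (cs.geomRep (t * w) - 1)
  omega

variable (cs) in
/-- Carter's lemma: the reflection length is at most the codimension of the fixed space. -/
theorem exists_prod_eq_of_finrank_movedSpace [Finite W] (w : W) :
    ∃ l : List W, (∀ t ∈ l, cs.IsReflection t) ∧ l.prod = w ∧
      l.length ≤ finrank ℝ (cs.movedSpace w) := by
  induction hn : finrank ℝ (cs.movedSpace w) using Nat.strong_induction_on generalizing w with
  | _ n ih =>
    rcases eq_or_ne w 1 with rfl | hw
    · exact ⟨[], by simp⟩
    obtain ⟨t, γ, ht, hγ⟩ := exists_hasRoot_orthogonal_fixed (cs := cs) hw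
    have hlt := finrank_movedSpace_mul_lt ht hγ
    obtain ⟨l, hl, hprod, hlen⟩ := ih _ (hn ▸ hlt) _ rfl
    refine ⟨t :: l, ?_, ?_, ?_⟩
    · simpa using ⟨ht.isReflection, hl⟩
    · rw [List.prod_cons, hprod, ← mul_assoc, ht.mul_self, one_mul]
    · rw [List.length_cons]
      omega

/-- Linear independence of the entries of a list of vectors. -/
def IndepList {V : Type*} [AddCommGroup V] [Module ℝ V] : List V → Prop
  | [] => True
  | a :: l => a ∉ Submodule.span ℝ {x | x ∈ l} ∧ IndepList l

section IndepList

variable {V : Type*} [AddCommGroup V] [Module ℝ V]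

theorem span_cons (a : V) (l : List V) : Submodule.span ℝ {x | x ∈ a :: l} =
    Submodule.span ℝ {a} ⊔ Submodule.span ℝ {x | x ∈ l} := by
  rw [← Submodule.span_insert]
  congr 1
  ext x
  simp

theorem finrank_span_cons_le [FiniteDimensional ℝ V] (a : V) (l : List V) :
    finrank ℝ (Submodule.span ℝ {x | x ∈ a :: l}) ≤
      finrank ℝ (Submodule.span ℝ {x | x ∈ l}) + 1 := by
  rw [span_cons]
  have h₁ := Submodule.finrank_add_le_finrank_add_finrank (Submodule.span ℝ {a})
    (Submodule.span ℝ {x | x ∈ l})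
  have h₂ : finrank ℝ (Submodule.span ℝ {a}) ≤ 1 := by
    simpa using finrank_span_le_card (R := ℝ) ({a} : Set V)
  omega

theorem finrank_span_le_length [FiniteDimensional ℝ V] (l : List V) :
    finrank ℝ (Submodule.span ℝ {x | x ∈ l}) ≤ l.length := by
  induction l with
  | nil => simp
  | cons a l ih =>
    have := finrank_span_cons_le a l
    rw [List.length_cons]
    omega

theorem indepList_of_length_le_finrank [FiniteDimensional ℝ V] {l : List V}
    (h : l.length ≤ finrank ℝ (Submodule.span ℝ {x | x ∈ l})) : IndepList l := by
  induction l with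
  | nil => trivial
  | cons a l ih =>
    have h₁ := finrank_span_cons_le a l
    rw [List.length_cons] at h
    refine ⟨fun ha ↦ ?_, ih (by omega)⟩
    rw [span_cons, sup_eq_right.mpr (by simpa using ha)] at h
    have := finrank_span_le_length l
    omega

theorem IndepList.finrank_span [FiniteDimensional ℝ V] {l : List V} (h : IndepList l) :
    finrank ℝ (Submodule.span ℝ {x | x ∈ l}) = l.length := by
  induction l with
  | nil => simp
  | cons a l ih =>
    refine le_antisymm (finrank_span_le_length _) ?_
    rw [List.length_cons, ← ih h.2, Nat.succ_le_iff]
    refine Submodule.finrank_lt_finrank_of_lt (SetLike.lt_iff_le_and_exists.mpr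
      ⟨Submodule.span_mono fun x hx ↦ List.mem_cons_of_mem _ hx, a,
        Submodule.subset_span List.mem_cons_self, h.1⟩)

end IndepList

theorem exists_hasRoot_list {l : List W} (hl : ∀ t ∈ l, cs.IsReflection t) :
    ∃ R, List.Forall₂ cs.HasRoot l R := by
  induction l with
  | nil => exact ⟨[], .nil⟩
  | cons t l ih =>
    obtain ⟨R, hR⟩ := ih fun u hu ↦ hl u (List.mem_cons_of_mem _ hu)
    obtain ⟨γ, hγ⟩ := (hl t List.mem_cons_self).exists_hasRoot
    exact ⟨γ :: R, .cons hγ hR⟩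

theorem exists_hasRoot_of_forall₂ {l : List W} {R : List (B →₀ ℝ)}
    (hR : List.Forall₂ cs.HasRoot l R) {t : W} (ht : t ∈ l) : ∃ γ ∈ R, cs.HasRoot t γ := by
  induction hR with
  | nil => simp at ht
  | cons h _ ih =>
    rcases List.mem_cons.mp ht with rfl | ht
    · exact ⟨_, List.mem_cons_self, h⟩
    · obtain ⟨γ, hγ, h⟩ := ih ht
      exact ⟨γ, List.mem_cons_of_mem _ hγ, h⟩

theorem exists_mem_of_forall₂ {l : List W} {R : List (B →₀ ℝ)}
    (hR : List.Forall₂ cs.HasRoot l R) {γ : B →₀ ℝ} (hγ : γ ∈ R) : ∃ t ∈ l, cs.HasRoot t γ := by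
  induction hR with
  | nil => simp at hγ
  | cons h _ ih =>
    rcases List.mem_cons.mp hγ with rfl | hγ
    · exact ⟨_, List.mem_cons_self, h⟩
    · obtain ⟨t, ht, h⟩ := ih hγ
      exact ⟨t, List.mem_cons_of_mem _ ht, h⟩

theorem exists_hasRoot_span {l : List W} {R : List (B →₀ ℝ)}
    (hR : List.Forall₂ cs.HasRoot l R) :
    ∀ t ∈ {t | t ∈ l}, ∃ γ ∈ Submodule.span ℝ {x | x ∈ R}, cs.HasRoot t γ := fun t ht ↦ by
  obtain ⟨γ, hγ, h⟩ := exists_hasRoot_of_forall₂ hR ht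
  exact ⟨γ, Submodule.subset_span hγ, h⟩

theorem prod_mem_closure (l : List W) : l.prod ∈ Subgroup.closure {t | t ∈ l} :=
  Subgroup.list_prod_mem _ fun _ ht ↦ Subgroup.subset_closure ht

/-- The roots of a short reflection factorization are linearly independent and span the moved
space. -/
theorem span_eq_movedSpace [Finite W] {l : List W} {R : List (B →₀ ℝ)}
    (hR : List.Forall₂ cs.HasRoot l R) (hl : l.length ≤ finrank ℝ (cs.movedSpace l.prod)) :
    IndepList R ∧ Submodule.span ℝ {x | x ∈ R} = cs.movedSpace l.prod := by
  have := cs.finite_index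
  have hle : cs.movedSpace l.prod ≤ Submodule.span ℝ {x | x ∈ R} := by
    rintro _ ⟨x, rfl⟩
    exact geomRep_sub_mem (exists_hasRoot_span hR) (prod_mem_closure l) x
  have h₁ := Submodule.finrank_mono hle
  have h₂ := finrank_span_le_length R
  have h₃ := hR.length_eq
  exact ⟨indepList_of_length_le_finrank (by omega),
    (Submodule.eq_of_le_of_finrank_le hle (by omega)).symm⟩

variable (cs) in
/-- A choice of a root for each reflection. -/
noncomputable def rootOf (t : W) : B →₀ ℝ :=
  open Classical in if h : ∃ γ, cs.HasRoot t γ then h.choose else 0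

theorem IsReflection.hasRoot_rootOf {t : W} (ht : cs.IsReflection t) :
    cs.HasRoot t (cs.rootOf t) := by
  have h := ht.exists_hasRoot
  rw [rootOf, dif_pos h]
  exact h.choose_spec

variable (cs) in
/-- The sign by which `g` maps the chosen root of `x` to the chosen root of `g x g⁻¹`. -/
noncomputable def rootSign (g x : W) : ℝ :=
  M.form (cs.geomRep g (cs.rootOf x)) (cs.rootOf (g * x * g⁻¹)) / 2

theorem IsReflection.geomRep_rootOf {x : W} (hx : cs.IsReflection x) (g : W) :
    cs.geomRep g (cs.rootOf x) = cs.rootSign g x • cs.rootOf (g * x * g⁻¹) := by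
  have h := (hx.conj g).hasRoot_rootOf
  have h' := hx.hasRoot_rootOf.conj g
  rcases h.eq_or_eq_neg h' with he | he <;>
  · rw [rootSign, he]
    simp [h.form_self]

theorem IsReflection.rootSign_eq {x : W} (hx : cs.IsReflection x) {g : W} {c : ℝ}
    (h : cs.geomRep g (cs.rootOf x) = c • cs.rootOf (g * x * g⁻¹)) : cs.rootSign g x = c := by
  rw [rootSign, h]
  simp [(hx.conj g).hasRoot_rootOf.form_self]

theorem IsReflection.rootSign_mul {x : W} (hx : cs.IsReflection x) (g h : W) :
    cs.rootSign (g * h) x = cs.rootSign g (h * x * h⁻¹) * cs.rootSign h x := by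
  apply hx.rootSign_eq
  rw [geomRep_mul_apply, hx.geomRep_rootOf, map_smul, (hx.conj h).geomRep_rootOf, smul_smul,
    mul_comm]
  congr 2
  group

theorem IsReflection.rootSign_one {x : W} (hx : cs.IsReflection x) : cs.rootSign 1 x = 1 :=
  hx.rootSign_eq (by simp)

theorem IsReflection.rootSign_self {x : W} (hx : cs.IsReflection x) : cs.rootSign x x = -1 :=
  hx.rootSign_eq (by simp [hx.hasRoot_rootOf.geomRep_apply_self])

theorem IsReflection.rootSign_of_commute {s x : W} (hs : cs.IsReflection s)
    (hx : cs.IsReflection x) (hsx : s * x * s⁻¹ = x) (hne : x ≠ s) : cs.rootSign s x = 1 := by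
  apply hx.rootSign_eq
  have h := hx.hasRoot_rootOf
  have h' := h.conj s
  rw [hsx] at h' ⊢
  rcases h.eq_or_eq_neg h' with he | he
  · rw [he, one_smul]
  · exfalso
    apply hne
    set γ := cs.rootOf x
    set δ := cs.rootOf s
    have hδ : cs.HasRoot s δ := hs.hasRoot_rootOf
    rw [hδ.geomRep_apply] at he
    have h₁ : (M.form γ δ / 2) • δ = γ := by
      rw [sub_eq_iff_eq_add, eq_neg_add_iff_add_eq, ← two_smul ℝ] at he
      rw [div_eq_inv_mul, mul_smul, ← he, smul_smul]
      norm_num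
    set c := M.form γ δ / 2
    have h₂ : c * c = 1 := by
      have h₂ := h.form_self
      rw [← h₁] at h₂
      simp only [map_smul, LinearMap.smul_apply, hδ.form_self, smul_eq_mul] at h₂
      linarith
    refine cs.geomRep_injective (LinearMap.ext fun y ↦ ?_)
    rw [h.geomRep_apply, hδ.geomRep_apply, ← h₁, map_smul, smul_eq_mul, smul_smul,
      mul_right_comm, h₂, one_mul]

theorem neg_one_pow_length_mul (g h : W) :
    (-1 : ℝ) ^ cs.length (g * h) = (-1) ^ cs.length g * (-1) ^ cs.length h := by
  rw [← pow_add]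
  have := cs.length_mul_mod_two g h
  apply neg_one_pow_congr
  rw [Nat.even_iff, Nat.even_iff, this]

/-- Every reflection in a subgroup generated by reflections is conjugate, in that subgroup, to
one of the generators. -/
theorem IsReflection.exists_conj_of_mem_closure [Finite W] {T : Set W}
    (hT : ∀ t ∈ T, cs.IsReflection t) {t : W} (ht : cs.IsReflection t)
    (htT : t ∈ Subgroup.closure T) : ∃ g ∈ Subgroup.closure T, ∃ u ∈ T, t = g * u * g⁻¹ := by
  classical
  have := Fintype.ofFinite W
  set G := Subgroup.closure T with hG
  set Ψ : Finset W := {x | ∃ g ∈ G, ∃ u ∈ T, x = g * u * g⁻¹} with hΨ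
  have hΨmem : ∀ x, x ∈ Ψ ↔ ∃ g ∈ G, ∃ u ∈ T, x = g * u * g⁻¹ := fun x ↦ by simp [hΨ]
  have hΨrefl : ∀ x ∈ Ψ, cs.IsReflection x := fun x hx ↦ by
    obtain ⟨g, -, u, hu, rfl⟩ := (hΨmem x).mp hx
    exact (hT u hu).conj g
  have hΨconj : ∀ h ∈ G, ∀ x ∈ Ψ, h * x * h⁻¹ ∈ Ψ := fun h hh x hx ↦ by
    obtain ⟨g, hg, u, hu, rfl⟩ := (hΨmem x).mp hx
    exact (hΨmem _).mpr ⟨h * g, mul_mem hh hg, u, hu, by group⟩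
  set ε : W → ℝ := fun g ↦ ∏ x ∈ Ψ, cs.rootSign g x with hε
  have hε_mul : ∀ g, ∀ h ∈ G, ε (g * h) = ε g * ε h := fun g h hh ↦ by
    have : ε g = ∏ x ∈ Ψ, cs.rootSign g (h * x * h⁻¹) := by
      symm
      refine Finset.prod_nbij' (fun x ↦ h * x * h⁻¹) (fun x ↦ h⁻¹ * x * h)
        (fun x hx ↦ hΨconj h hh x hx) (fun x hx ↦ ?_) (fun x _ ↦ by group) (fun x _ ↦ by group)
        (fun x _ ↦ rfl)
      simpa using hΨconj h⁻¹ (inv_mem hh) x hx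
    rw [this, ← Finset.prod_mul_distrib]
    exact Finset.prod_congr rfl fun x hx ↦ (hΨrefl x hx).rootSign_mul g h
  have hε_one : ε 1 = 1 := Finset.prod_eq_one fun x hx ↦ (hΨrefl x hx).rootSign_one
  have hε_refl : ∀ s ∈ G, cs.IsReflection s → ∏ x ∈ Ψ.erase s, cs.rootSign s x = 1 := by
    intro s hsG hs
    refine Finset.prod_involution (fun x _ ↦ s * x * s⁻¹) (fun x hx ↦ ?_) (fun x hx h ↦ ?_)
      (fun x hx ↦ ?_) (fun x hx ↦ ?_)
    · have hxr := hΨrefl x (Finset.mem_of_mem_erase hx)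
      rw [mul_comm, ← hxr.rootSign_mul, hs.mul_self, hxr.rootSign_one]
    · contrapose! h
      exact hs.rootSign_of_commute (hΨrefl x (Finset.mem_of_mem_erase hx)) h
        (Finset.ne_of_mem_erase hx)
    · refine Finset.mem_erase.mpr ⟨fun h ↦ Finset.ne_of_mem_erase hx ?_,
        hΨconj s hsG x (Finset.mem_of_mem_erase hx)⟩
      rwa [mul_inv_eq_iff_eq_mul, mul_right_inj] at h
    · simp only [hs.inv]
      rw [← mul_assoc, ← mul_assoc, hs.mul_self, one_mul, mul_assoc, hs.mul_self, mul_one]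
  have hε_sign : ∀ g ∈ G, ε g = (-1) ^ cs.length g := fun g hg ↦ by
    induction hg using Subgroup.closure_induction with
    | mem s hs =>
      have hsG : s ∈ G := Subgroup.subset_closure hs
      have hsΨ : s ∈ Ψ := (hΨmem s).mpr ⟨1, one_mem _, s, hs, by simp⟩
      simp only [hε]
      rw [← Finset.mul_prod_erase _ _ hsΨ, hε_refl s hsG (hT s hs), (hT s hs).rootSign_self,
        (hT s hs).odd_length.neg_one_pow, mul_one]
    | one => simp [hε_one]
    | mul g h _ hh ihg ihh => rw [hε_mul g h hh, ihg, ihh, neg_one_pow_length_mul]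
    | inv g hg ih =>
      have h₁ := hε_mul g⁻¹ g hg
      rw [inv_mul_cancel, hε_one, ih] at h₁
      rw [cs.length_inv]
      rcases neg_one_pow_eq_or ℝ (cs.length g) with h₂ | h₂ <;> rw [h₂] at h₁ ⊢ <;> linarith
  by_contra h
  rw [← hΨmem] at h
  have h₁ := hε_refl t htT ht
  rw [Finset.erase_eq_of_notMem h] at h₁
  have h₂ := hε_sign t htT
  rw [ht.odd_length.neg_one_pow] at h₂
  simp only [hε] at h₂
  linarith

/-- Every root supported on `S` is the image of a simple root under the standard parabolic
subgroup. -/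
theorem HasRoot.exists_geomRep_simpleRoot_eq [Finite W] {t : W} {γ : B →₀ ℝ}
    (h : cs.HasRoot t γ) {S : Set B} (hγ : γ ∈ Finsupp.supported ℝ ℝ S) :
    ∃ g ∈ cs.standardParabolic S, ∃ i ∈ S, t = g * cs.simple i * g⁻¹ ∧
      γ = cs.geomRep g (simpleRoot i) := by
  obtain ⟨g, hg, _, ⟨i, hi, rfl⟩, hgi⟩ := h.isReflection.exists_conj_of_mem_closure
    (T := cs.simple '' S) (by rintro _ ⟨i, -, rfl⟩; exact cs.isReflection_simple i)
    (h.mem_standardParabolic hγ)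
  have h' : cs.HasRoot t (cs.geomRep g (simpleRoot i)) := ⟨g, i, hgi, rfl⟩
  rcases h'.eq_or_eq_neg h with he | he
  · exact ⟨g, hg, i, hi, hgi, he⟩
  · refine ⟨g * cs.simple i, mul_mem hg (simple_mem_standardParabolic hi), i, hi, ?_, ?_⟩
    · simp [hgi, mul_assoc]
    · rw [geomRep_mul_apply, geomRep_simple_simpleRoot, map_neg, he]

end CoxeterSystem

/-! ### Generation of standard parabolic subgroups -/

namespace CoxeterSystem

open CoxeterMatrix Module

variable {B W : Type*} [Group W] {M : CoxeterMatrix B} {cs : CoxeterSystem M W}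

theorem HasRoot.mem_of_mem_closure {N : Submodule ℝ (B →₀ ℝ)} {T : Set W}
    (hT : ∀ t ∈ T, ∃ γ ∈ N, cs.HasRoot t γ) {t : W} {γ : B →₀ ℝ} (h : cs.HasRoot t γ)
    (ht : t ∈ Subgroup.closure T) : γ ∈ N := by
  have := geomRep_sub_mem hT ht γ
  rw [h.geomRep_apply_self, ← neg_add', Submodule.neg_mem_iff, ← two_smul ℝ] at this
  exact (N.smul_mem_iff two_ne_zero).mp this

theorem forall_mem_standardParabolic [Finite W] {l : List W} {R : List (B →₀ ℝ)}
    (hR : List.Forall₂ cs.HasRoot l R) {S : Set B}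
    (hS : Submodule.span ℝ {x | x ∈ R} ≤ Finsupp.supported ℝ ℝ S) {t : W} (ht : t ∈ l) :
    t ∈ cs.standardParabolic S := by
  obtain ⟨γ, hγ, h⟩ := exists_hasRoot_of_forall₂ hR ht
  exact h.mem_standardParabolic (hS (Submodule.subset_span hγ))

variable (cs) in
/-- A factorization of an element into reflections whose roots form a basis of the space spanned
by the simple roots in `S`. -/
structure IsBasisFactorization (S : Set B) (w : W) (l : List W) (R : List (B →₀ ℝ)) : Prop where
  hasRoot : List.Forall₂ cs.HasRoot l R
  indep : IndepList R
  span_eq : Submodule.span ℝ {x | x ∈ R} = Finsupp.supported ℝ ℝ S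
  prod_eq : l.prod = w

variable (cs) in
/-- If one basis factorization of an element generates the standard parabolic subgroup of `S`,
then all of them do. -/
def GenerationTransfers (S : Set B) : Prop :=
  ∀ ⦃w l R l' R'⦄, cs.IsBasisFactorization S w l R → cs.IsBasisFactorization S w l' R' →
    Subgroup.closure {t | t ∈ l} = cs.standardParabolic S →
      cs.standardParabolic S ≤ Subgroup.closure {t | t ∈ l'}

section Orthogonal

variable {C D : Set B}

theorem form_eq_zero_of_supported
    (hCD : ∀ c ∈ C, ∀ d ∈ D, M.form (simpleRoot c) (simpleRoot d) = 0) {x y : B →₀ ℝ}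
    (hx : x ∈ Finsupp.supported ℝ ℝ C) (hy : y ∈ Finsupp.supported ℝ ℝ D) : M.form x y = 0 := by
  rw [form_apply_eq_sum]
  refine Finset.sum_eq_zero fun d hd ↦ ?_
  change y d * M.form x (simpleRoot d) = 0
  rw [M.form_comm, form_apply_eq_sum]
  refine mul_eq_zero_of_right _ (Finset.sum_eq_zero fun c hc ↦ ?_)
  simp only [M.form_comm (simpleRoot d), hCD c (hx hc) d (hy hd), mul_zero]

theorem geomRep_eq_self_of_supported
    (hCD : ∀ c ∈ C, ∀ d ∈ D, M.form (simpleRoot c) (simpleRoot d) = 0) {x : B →₀ ℝ}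
    (hx : x ∈ Finsupp.supported ℝ ℝ C) {g : W} (hg : g ∈ cs.standardParabolic D) :
    cs.geomRep g x = x := by
  refine geomRep_eq_self_of_orthogonal (T := cs.simple '' D) ?_ hg
  rintro _ ⟨d, hd, rfl⟩
  exact ⟨_, form_eq_zero_of_supported hCD hx (simpleRoot_mem_supported hd), cs.hasRoot_simple d⟩

theorem commute_of_orthogonal
    (hCD : ∀ c ∈ C, ∀ d ∈ D, M.form (simpleRoot c) (simpleRoot d) = 0) {g h : W}
    (hg : g ∈ cs.standardParabolic C) (hh : h ∈ cs.standardParabolic D) : Commute g h := by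
  have hDC : ∀ d ∈ D, ∀ c ∈ C, M.form (simpleRoot d) (simpleRoot c) = 0 :=
    fun d hd c hc ↦ by rw [M.form_comm, hCD c hc d hd]
  refine cs.geomRep_injective (LinearMap.ext fun x ↦ ?_)
  have h₁ := geomRep_eq_self_of_supported (cs := cs) hDC
    (geomRep_sub_mem (exists_hasRoot_supported D) hh x) hg
  have h₂ := geomRep_eq_self_of_supported (cs := cs) hCD
    (geomRep_sub_mem (exists_hasRoot_supported C) hg x) hh
  rw [map_sub] at h₁ h₂
  rw [geomRep_mul_apply, geomRep_mul_apply, sub_eq_iff_eq_add.mp h₁, sub_eq_iff_eq_add.mp h₂]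
  abel

theorem disjoint_supported (hdisj : Disjoint C D) {x : B →₀ ℝ}
    (hC : x ∈ Finsupp.supported ℝ ℝ C) (hD : x ∈ Finsupp.supported ℝ ℝ D) : x = 0 := by
  have := (Finsupp.disjoint_supported_supported (M := ℝ) (R := ℝ) hdisj).le_bot ⟨hC, hD⟩
  simpa using this

theorem eq_one_of_mem_of_mem (hdisj : Disjoint C D) {g : W} (hC : g ∈ cs.standardParabolic C)
    (hD : g ∈ cs.standardParabolic D) : g = 1 := by
  refine cs.geomRep_injective (LinearMap.ext fun x ↦ ?_)
  rw [geomRep_one_apply, ← sub_eq_zero]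
  exact disjoint_supported hdisj (geomRep_sub_mem (exists_hasRoot_supported C) hC x)
    (geomRep_sub_mem (exists_hasRoot_supported D) hD x)

theorem HasRoot.supported_or_supported [Finite W]
    (hCD : ∀ c ∈ C, ∀ d ∈ D, M.form (simpleRoot c) (simpleRoot d) = 0) {t : W} {γ : B →₀ ℝ}
    (h : cs.HasRoot t γ) (hγ : γ ∈ Finsupp.supported ℝ ℝ (C ∪ D)) :
    γ ∈ Finsupp.supported ℝ ℝ C ∨ γ ∈ Finsupp.supported ℝ ℝ D := by
  have hDC : ∀ d ∈ D, ∀ c ∈ C, M.form (simpleRoot d) (simpleRoot c) = 0 :=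
    fun d hd c hc ↦ by rw [M.form_comm, hCD c hc d hd]
  have key : ∀ g ∈ cs.standardParabolic (C ∪ D), ∃ c ∈ cs.standardParabolic C,
      ∃ d ∈ cs.standardParabolic D, g = c * d := fun g hg ↦ by
    induction hg using Subgroup.closure_induction with
    | mem s hs =>
      obtain ⟨i, hi | hi, rfl⟩ := hs
      · exact ⟨_, simple_mem_standardParabolic hi, 1, one_mem _, by simp⟩
      · exact ⟨1, one_mem _, _, simple_mem_standardParabolic hi, by simp⟩
    | one => exact ⟨1, one_mem _, 1, one_mem _, by simp⟩
    | mul g h _ _ ihg ihh =>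
      obtain ⟨c, hc, d, hd, rfl⟩ := ihg
      obtain ⟨c', hc', d', hd', rfl⟩ := ihh
      exact ⟨c * c', mul_mem hc hc', d * d', mul_mem hd hd',
        (commute_of_orthogonal hCD hc' hd).symm.mul_mul_mul_comm _ _⟩
    | inv g _ ih =>
      obtain ⟨c, hc, d, hd, rfl⟩ := ih
      exact ⟨c⁻¹, inv_mem hc, d⁻¹, inv_mem hd, by
        rw [mul_inv_rev, (commute_of_orthogonal hCD (inv_mem hc) (inv_mem hd)).eq]⟩
  obtain ⟨g, hg, i, hi, -, rfl⟩ := h.exists_geomRep_simpleRoot_eq hγ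
  obtain ⟨c, hc, d, hd, rfl⟩ := key g hg
  rcases hi with hi | hi
  · left
    rw [geomRep_mul_apply, geomRep_eq_self_of_supported hCD (simpleRoot_mem_supported hi) hd]
    exact geomRep_mem_supported hc (simpleRoot_mem_supported hi)
  · right
    rw [(commute_of_orthogonal hCD hc hd).eq, geomRep_mul_apply,
      geomRep_eq_self_of_supported hDC (simpleRoot_mem_supported hi) hc]
    exact geomRep_mem_supported hd (simpleRoot_mem_supported hi)

theorem exists_split_list [Finite W]
    (hCD : ∀ c ∈ C, ∀ d ∈ D, M.form (simpleRoot c) (simpleRoot d) = 0) {l : List W}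
    {R : List (B →₀ ℝ)} (hR : List.Forall₂ cs.HasRoot l R) (hind : IndepList R)
    (hmem : ∀ γ ∈ R, γ ∈ Finsupp.supported ℝ ℝ C ∨ γ ∈ Finsupp.supported ℝ ℝ D) :
    ∃ (lC : List W) (RC : List (B →₀ ℝ)) (lD : List W), List.Forall₂ cs.HasRoot lC RC ∧
      IndepList RC ∧ (∀ γ ∈ RC, γ ∈ R) ∧
      (∀ t ∈ lC, t ∈ l) ∧ (∀ γ ∈ R, γ ∈ RC ∨ γ ∈ Finsupp.supported ℝ ℝ D) ∧
      (∀ γ ∈ RC, γ ∈ Finsupp.supported ℝ ℝ C) ∧ (∀ t ∈ lD, t ∈ cs.standardParabolic D) ∧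
      l.prod = lC.prod * lD.prod ∧ ∀ t ∈ l, t ∈ lC ∨ t ∈ lD := by
  induction hR with
  | nil => exact ⟨[], [], [], .nil, by simp [IndepList]⟩
  | @cons t γ l R h hR ih =>
    obtain ⟨lC, RC, lD, h₁, h₂, h₃, h₄, h₅, h₆, h₇, h₈, h₉⟩ :=
      ih hind.2 fun γ hγ ↦ hmem γ (List.mem_cons_of_mem _ hγ)
    rcases hmem γ List.mem_cons_self with hγ | hγ
    · refine ⟨t :: lC, γ :: RC, lD, .cons h h₁,
        ⟨fun hs ↦ hind.1 (Submodule.span_mono (fun δ hδ ↦ h₃ δ hδ) hs), h₂⟩, ?_, ?_, ?_, ?_, h₇,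
        ?_, ?_⟩
      · simp only [List.mem_cons]
        grind
      · simp only [List.mem_cons]
        grind
      · simp only [List.mem_cons]
        grind
      · simp only [List.mem_cons]
        grind
      · rw [List.prod_cons, List.prod_cons, h₈, mul_assoc]
      · simp only [List.mem_cons]
        grind
    · have ht := h.mem_standardParabolic hγ
      refine ⟨lC, RC, t :: lD, h₁, h₂, ?_, ?_, ?_, h₆, ?_, ?_, ?_⟩
      · simp only [List.mem_cons]
        grind
      · simp only [List.mem_cons]
        grind
      · simp only [List.mem_cons]
        grind
      · simp only [List.mem_cons]
        grind
      · have hC : lC.prod ∈ cs.standardParabolic C := Subgroup.list_prod_mem _ fun u hu ↦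
          forall_mem_standardParabolic h₁ (Submodule.span_le.mpr fun δ hδ ↦ h₆ δ hδ) hu
        rw [List.prod_cons, List.prod_cons, h₈, ← mul_assoc, ← mul_assoc,
          (commute_of_orthogonal hCD hC ht).eq]
      · simp only [List.mem_cons]
        grind

theorem IsBasisFactorization.exists_restrict [Finite W]
    (hCD : ∀ c ∈ C, ∀ d ∈ D, M.form (simpleRoot c) (simpleRoot d) = 0) (hdisj : Disjoint C D)
    {w : W} {l : List W} {R : List (B →₀ ℝ)} (h : cs.IsBasisFactorization (C ∪ D) w l R) :
    ∃ c ∈ cs.standardParabolic C, ∃ d ∈ cs.standardParabolic D, w = c * d ∧ ∃ lC RC,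
      cs.IsBasisFactorization C c lC RC ∧ (∀ t ∈ lC, t ∈ l) ∧
        ∀ t ∈ l, t ∈ lC ∨ t ∈ cs.standardParabolic D := by
  obtain ⟨lC, RC, lD, h₁, h₂, h₃, h₄, h₅, h₆, h₇, h₈, h₉⟩ :=
    exists_split_list hCD h.hasRoot h.indep fun γ hγ ↦ by
      obtain ⟨t, -, ht⟩ := exists_mem_of_forall₂ h.hasRoot hγ
      exact ht.supported_or_supported hCD (h.span_eq.le (Submodule.subset_span hγ))
  have hle : Submodule.span ℝ {x | x ∈ RC} ≤ Finsupp.supported ℝ ℝ C :=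
    Submodule.span_le.mpr fun δ hδ ↦ h₆ δ hδ
  refine ⟨lC.prod, Subgroup.list_prod_mem _ fun t ht ↦ forall_mem_standardParabolic h₁ hle ht,
    lD.prod, Subgroup.list_prod_mem _ h₇, h.prod_eq ▸ h₈, lC, RC,
    ⟨h₁, h₂, le_antisymm hle fun x hx ↦ ?_, rfl⟩, h₄, fun t ht ↦ (h₉ t ht).imp_right (h₇ t)⟩
  have hx' : x ∈ Submodule.span ℝ {x | x ∈ RC} ⊔ Finsupp.supported ℝ ℝ D := by
    have : Submodule.span ℝ {x | x ∈ R} ≤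
        Submodule.span ℝ {x | x ∈ RC} ⊔ Finsupp.supported ℝ ℝ D :=
      Submodule.span_le.mpr fun γ hγ ↦ (h₅ γ hγ).elim
        (fun hγ ↦ Submodule.mem_sup_left (Submodule.subset_span hγ)) Submodule.mem_sup_right
    exact this (h.span_eq.ge (Finsupp.supported_mono Set.subset_union_left hx))
  obtain ⟨y, hy, z, hz, rfl⟩ := Submodule.mem_sup.mp hx'
  have hz0 : z = 0 := disjoint_supported hdisj
    ((Submodule.add_mem_iff_right _ (hle hy)).mp hx) hz
  rwa [hz0, add_zero]

theorem standardParabolic_le_of_orthogonal [Finite W]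
    (hCD : ∀ c ∈ C, ∀ d ∈ D, M.form (simpleRoot c) (simpleRoot d) = 0) (hdisj : Disjoint C D)
    (hC : cs.GenerationTransfers C) {w : W} {l l' : List W} {R R' : List (B →₀ ℝ)}
    (h : cs.IsBasisFactorization (C ∪ D) w l R) (h' : cs.IsBasisFactorization (C ∪ D) w l' R')
    (hl : Subgroup.closure {t | t ∈ l} = cs.standardParabolic (C ∪ D)) :
    cs.standardParabolic C ≤ Subgroup.closure {t | t ∈ l'} := by
  obtain ⟨c, hc, d, hd, hw, lC, RC, hlC, -, hsub⟩ := h.exists_restrict hCD hdisj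
  obtain ⟨c', hc', d', hd', hw', lC', RC', hlC', hsub', -⟩ := h'.exists_restrict hCD hdisj
  have hcc : c = c' := by
    rw [hw] at hw'
    rw [← inv_mul_eq_one, eq_comm]
    symm
    refine eq_one_of_mem_of_mem (cs := cs) hdisj (mul_mem (inv_mem hc) hc') ?_
    have : c⁻¹ * c' = d * d'⁻¹ := by
      rw [inv_mul_eq_iff_eq_mul, ← mul_assoc, eq_mul_inv_iff_mul_eq]
      exact hw'.symm
    rw [this]
    exact mul_mem hd (inv_mem hd')
  subst hcc
  have hmemC : ∀ t ∈ lC, t ∈ cs.standardParabolic C := fun t ht ↦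
    forall_mem_standardParabolic hlC.hasRoot hlC.span_eq.le ht
  have hleC : Subgroup.closure {t | t ∈ lC} ≤ cs.standardParabolic C :=
    (Subgroup.closure_le _).mpr hmemC
  have key : ∀ g ∈ Subgroup.closure {t | t ∈ l}, ∃ c ∈ Subgroup.closure {t | t ∈ lC},
      ∃ d ∈ cs.standardParabolic D, g = c * d := fun g hg ↦ by
    induction hg using Subgroup.closure_induction with
    | mem t ht =>
      rcases hsub t ht with ht | ht
      · exact ⟨t, Subgroup.subset_closure ht, 1, one_mem _, by simp⟩
      · exact ⟨1, one_mem _, t, ht, by simp⟩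
    | one => exact ⟨1, one_mem _, 1, one_mem _, by simp⟩
    | mul g h _ _ ihg ihh =>
      obtain ⟨c, hc, d, hd, rfl⟩ := ihg
      obtain ⟨c', hc', d', hd', rfl⟩ := ihh
      exact ⟨c * c', mul_mem hc hc', d * d', mul_mem hd hd',
        (commute_of_orthogonal hCD (hleC hc') hd).symm.mul_mul_mul_comm _ _⟩
    | inv g _ ih =>
      obtain ⟨c, hc, d, hd, rfl⟩ := ih
      exact ⟨c⁻¹, inv_mem hc, d⁻¹, inv_mem hd, by
        rw [mul_inv_rev, (commute_of_orthogonal hCD (inv_mem (hleC hc)) (inv_mem hd)).eq]⟩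
  refine (hC hlC hlC' (le_antisymm hleC ?_)).trans (Subgroup.closure_mono fun t ht ↦ hsub' t ht)
  rw [standardParabolic, Subgroup.closure_le]
  rintro _ ⟨i, hi, rfl⟩
  obtain ⟨g, hg, e, he, hge⟩ := key (cs.simple i)
    (hl ▸ simple_mem_standardParabolic (Set.mem_union_left D hi))
  have : e = 1 := by
    refine eq_one_of_mem_of_mem (cs := cs) hdisj ?_ he
    rw [← inv_mul_eq_iff_eq_mul.mpr hge]
    exact mul_mem (inv_mem (hleC hg)) (simple_mem_standardParabolic hi)
  rw [hge, this, mul_one]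
  exact hg

/-- Generation can be tested on orthogonal components. -/
theorem GenerationTransfers.union [Finite W]
    (hCD : ∀ c ∈ C, ∀ d ∈ D, M.form (simpleRoot c) (simpleRoot d) = 0) (hdisj : Disjoint C D)
    (hC : cs.GenerationTransfers C) (hD : cs.GenerationTransfers D) :
    cs.GenerationTransfers (C ∪ D) := by
  intro w l R l' R' h h' hl
  have h₁ := standardParabolic_le_of_orthogonal hCD hdisj hC h h' hl
  rw [Set.union_comm] at h h' hl
  have h₂ := standardParabolic_le_of_orthogonal
    (fun d hd c hc ↦ by rw [M.form_comm, hCD c hc d hd]) hdisj.symm hD h h' hl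
  rw [standardParabolic, Subgroup.closure_le]
  rintro _ ⟨i, hi | hi, rfl⟩
  · exact h₁ (simple_mem_standardParabolic hi)
  · exact h₂ (simple_mem_standardParabolic hi)

end Orthogonal

theorem finrank_supported_pair {i j : B} (hij : i ≠ j) :
    finrank ℝ (Finsupp.supported ℝ ℝ ({i, j} : Set B)) = 2 := by
  classical
  rw [(Finsupp.supportedEquivFinsupp (M := ℝ) (R := ℝ) ({i, j} : Set B)).finrank_eq,
    Module.finrank_finsupp_self, Set.card_insert _ (by simpa using hij)]
  simp

theorem generationTransfers_pair [Finite W] (cs : CoxeterSystem M W) {i j : B} (hij : i ≠ j) :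
    cs.GenerationTransfers {i, j} := by
  intro w l R l' R' h h' hl
  have := cs.finite_index
  have hlen : l.length = 2 := by
    rw [h.hasRoot.length_eq, ← h.indep.finrank_span, h.span_eq, finrank_supported_pair hij]
  have hlen' : l'.length = 2 := by
    rw [h'.hasRoot.length_eq, ← h'.indep.finrank_span, h'.span_eq, finrank_supported_pair hij]
  obtain ⟨t₁, t₂, rfl⟩ := List.length_eq_two.mp hlen
  obtain ⟨u₁, u₂, rfl⟩ := List.length_eq_two.mp hlen'
  have hrefl : ∀ {l : List W} {R : List (B →₀ ℝ)}, List.Forall₂ cs.HasRoot l R →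
      ∀ t ∈ l, cs.IsReflection t := fun hR t ht ↦ by
    obtain ⟨γ, -, hγ⟩ := exists_hasRoot_of_forall₂ hR ht
    exact hγ.isReflection
  have ht₁ := hrefl h.hasRoot t₁ (by simp)
  have ht₂ := hrefl h.hasRoot t₂ (by simp)
  have hu₁ := hrefl h'.hasRoot u₁ (by simp)
  have hw : t₁ * t₂ = w := by simpa using h.prod_eq
  have hw' : w ∈ Subgroup.closure {t | t ∈ [u₁, u₂]} := h'.prod_eq ▸ prod_mem_closure _
  have ht₂w : t₂ = t₁ * w := by rw [← hw, ← mul_assoc, ht₁.mul_self, one_mul]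
  have hconj : t₁ * w * t₁⁻¹ = w⁻¹ := by
    rw [← hw, ← mul_assoc, ht₁.mul_self, one_mul, mul_inv_rev, ht₂.inv]
  have hconj' : ∀ k : ℤ, w ^ k * t₁ = t₁ * w ^ (-k) := fun k ↦ by
    have := conj_zpow (a := t₁) (b := w) (i := -k)
    rw [hconj, inv_zpow, zpow_neg, inv_inv, eq_mul_inv_iff_mul_eq] at this
    rw [this, zpow_neg]
  have key : ∀ g ∈ Subgroup.closure {t | t ∈ [t₁, t₂]}, ∃ k : ℤ, g = w ^ k ∨ g = t₁ * w ^ k := by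
    intro g hg
    induction hg using Subgroup.closure_induction with
    | mem t ht =>
      rcases (by simpa using ht : t = t₁ ∨ t = t₂) with rfl | rfl
      · exact ⟨0, .inr (by simp)⟩
      · exact ⟨1, .inr (by simpa using ht₂w)⟩
    | one => exact ⟨0, .inl (by simp)⟩
    | mul g h _ _ ihg ihh =>
      obtain ⟨a, rfl | rfl⟩ := ihg <;> obtain ⟨b, rfl | rfl⟩ := ihh
      · exact ⟨a + b, .inl (zpow_add w a b).symm⟩
      · exact ⟨-a + b, .inr (by rw [← mul_assoc, hconj', zpow_add, mul_assoc])⟩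
      · exact ⟨a + b, .inr (by rw [zpow_add, mul_assoc])⟩
      · refine ⟨-a + b, .inl ?_⟩
        rw [mul_assoc, ← mul_assoc (w ^ a), hconj', ← mul_assoc, ← mul_assoc, ht₁.mul_self,
          one_mul, zpow_add]
    | inv g _ ih =>
      obtain ⟨a, rfl | rfl⟩ := ih
      · exact ⟨-a, .inl (zpow_neg w a).symm⟩
      · exact ⟨a, .inr (by rw [mul_inv_rev, ht₁.inv, ← zpow_neg, hconj', neg_neg])⟩
  have hparity : ∀ {t}, cs.IsReflection t → cs.lengthParity t = Multiplicative.ofAdd 1 :=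
    fun ht ↦ by
      rw [cs.lengthParity_eq_ofAdd_length, ZMod.natCast_eq_one_iff_odd.mpr ht.odd_length]
  have hu₁W : u₁ ∈ Subgroup.closure {t | t ∈ [t₁, t₂]} := by
    rw [hl]
    exact forall_mem_standardParabolic h'.hasRoot h'.span_eq.le (by simp)
  obtain ⟨k, hk | hk⟩ := key u₁ hu₁W
  · exfalso
    have h₁ := hparity hu₁
    rw [hk, map_zpow, ← hw, map_mul, hparity ht₁, hparity ht₂] at h₁
    have h₂ : Multiplicative.ofAdd (1 : ZMod 2) * Multiplicative.ofAdd 1 = 1 := by decide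
    rw [h₂, one_zpow] at h₁
    exact absurd h₁ (by decide)
  · have h₁ : t₁ ∈ Subgroup.closure {t | t ∈ [u₁, u₂]} := by
      rw [eq_mul_inv_iff_mul_eq.mpr hk.symm]
      exact mul_mem (Subgroup.subset_closure (by simp)) (inv_mem (zpow_mem hw' k))
    rw [← hl, Subgroup.closure_le]
    intro t ht
    rcases (by simpa using ht : t = t₁ ∨ t = t₂) with rfl | rfl
    · exact h₁
    · rw [ht₂w]
      exact mul_mem h₁ hw'

end CoxeterSystem

/-! ### Inner products of roots -/

namespace CoxeterSystem

open CoxeterMatrix Module goldenRatio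

variable {B W : Type*} [Group W] {M : CoxeterMatrix B} {cs : CoxeterSystem M W}

/-- The possible inner products of two roots when all bonds have label at most `5`. -/
def IsRootProduct (x : ℝ) : Prop :=
  x = 0 ∨ x = 1 ∨ x = -1 ∨ x = √2 ∨ x = -√2 ∨ x = φ ∨ x = -φ ∨ x = φ - 1 ∨ x = 1 - φ ∨
    x = 2 ∨ x = -2

theorem form_simpleRoot_left_of_mem {i j : B} {D : ℝ → ℝ → Prop}
    (h₁ : ∀ u v, D u v → D (-u) (v - M.form (simpleRoot i) (simpleRoot j) * u))
    (h₂ : ∀ u v, D u v → D (u - M.form (simpleRoot i) (simpleRoot j) * v) (-v)) {g : W}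
    (hg : g ∈ cs.standardParabolic {i, j}) {x : B →₀ ℝ}
    (hx : D (M.form (simpleRoot i) x) (M.form (simpleRoot j) x)) :
    D (M.form (simpleRoot i) (cs.geomRep g x)) (M.form (simpleRoot j) (cs.geomRep g x)) := by
  have step : ∀ y, D (M.form (simpleRoot i) y) (M.form (simpleRoot j) y) →
      ∀ s ∈ cs.simple '' {i, j}, D (M.form (simpleRoot i) (cs.geomRep s y))
        (M.form (simpleRoot j) (cs.geomRep s y)) := by
    rintro y hy _ ⟨k, rfl | rfl, rfl⟩
    · convert h₁ _ _ hy using 1 <;>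
      · simp only [geomRep_simple_apply, map_sub, map_smul, form_simpleRoot_self, smul_eq_mul]
        rw [M.form_comm y]
        try rw [M.form_comm (simpleRoot k) (simpleRoot j)]
        ring
    · convert h₂ _ _ hy using 1 <;>
      · simp only [geomRep_simple_apply, map_sub, map_smul, form_simpleRoot_self, smul_eq_mul]
        rw [M.form_comm y]
        ring
  induction hg using Subgroup.closure_induction_left with
  | one => simpa using hx
  | mul_left s hs y _ ih =>
    rw [geomRep_mul_apply]
    exact step _ ih s hs
  | inv_mul_cancel s hs y _ ih =>
    rw [geomRep_mul_apply]
    refine step _ ih _ ?_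
    obtain ⟨k, hk, rfl⟩ := hs
    exact ⟨k, hk, (cs.inv_simple k).symm⟩

theorem isRootProduct_form_of_pair {i j : B} {D : ℝ → ℝ → Prop}
    (h₁ : ∀ u v, D u v → D (-u) (v - M.form (simpleRoot i) (simpleRoot j) * u))
    (h₂ : ∀ u v, D u v → D (u - M.form (simpleRoot i) (simpleRoot j) * v) (-v))
    (h₃ : D 2 (M.form (simpleRoot i) (simpleRoot j)))
    (h₄ : D (M.form (simpleRoot i) (simpleRoot j)) 2)
    (h₅ : ∀ u v, D u v → IsRootProduct u ∧ IsRootProduct v) {g : W}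
    (hg : g ∈ cs.standardParabolic {i, j}) {x y : B} (hx : x = i ∨ x = j) (hy : y = i ∨ y = j) :
    IsRootProduct (M.form (simpleRoot x) (cs.geomRep g (simpleRoot y))) := by
  have hy' : D (M.form (simpleRoot i) (simpleRoot y)) (M.form (simpleRoot j) (simpleRoot y)) := by
    rcases hy with rfl | rfl
    · rwa [form_simpleRoot_self, M.form_comm]
    · rwa [form_simpleRoot_self]
  have := h₅ _ _ (form_simpleRoot_left_of_mem h₁ h₂ hg hy')
  rcases hx with rfl | rfl
  · exact this.1
  · exact this.2

theorem isRootProduct_form_of_eq_five {i j : B}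
    (hf : M.form (simpleRoot i) (simpleRoot j) = -φ) {g : W}
    (hg : g ∈ cs.standardParabolic {i, j}) {x y : B} (hx : x = i ∨ x = j) (hy : y = i ∨ y = j) :
    IsRootProduct (M.form (simpleRoot x) (cs.geomRep g (simpleRoot y))) := by
  have hφ : φ ^ 2 = φ + 1 := goldenRatio_sq
  refine isRootProduct_form_of_pair (D := fun u v ↦ (u = 2 ∧ v = -φ) ∨ (u = -2 ∧ v = φ) ∨
    (u = -φ ∧ v = 2) ∨ (u = φ ∧ v = -2) ∨ (u = 1 - φ ∧ v = φ) ∨ (u = φ - 1 ∧ v = -φ) ∨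
    (u = φ ∧ v = 1 - φ) ∨ (u = -φ ∧ v = φ - 1) ∨ (u = φ - 1 ∧ v = φ - 1) ∨
    (u = 1 - φ ∧ v = 1 - φ)) ?_ ?_ ?_ ?_ ?_ hg hx hy <;> simp only [hf, IsRootProduct]
  all_goals
    clear hf
    generalize φ = p at *
  iterate 2
    · rintro u v (⟨rfl, rfl⟩ | ⟨rfl, rfl⟩ | ⟨rfl, rfl⟩ | ⟨rfl, rfl⟩ | ⟨rfl, rfl⟩ | ⟨rfl, rfl⟩ |
        ⟨rfl, rfl⟩ | ⟨rfl, rfl⟩ | ⟨rfl, rfl⟩ | ⟨rfl, rfl⟩)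
      all_goals grind
  all_goals grind

theorem isRootProduct_form_geomRep {i j : B} (h0 : M i j ≠ 0) (h5 : M i j ≤ 5) {g : W}
    (hg : g ∈ cs.standardParabolic {i, j}) {x y : B} (hx : x = i ∨ x = j) (hy : y = i ∨ y = j) :
    IsRootProduct (M.form (simpleRoot x) (cs.geomRep g (simpleRoot y))) := by
  have h2 : √2 ^ 2 = 2 := sq_sqrt two_pos.le
  have hf := M.form_simpleRoot i j
  have hcases : M i j = 1 ∨ M i j = 2 ∨ M i j = 3 ∨ M i j = 4 ∨ M i j = 5 := by omega
  rcases hcases with hm | hm | hm | hm | hm <;> rw [hm] at hf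
  · replace hf : M.form (simpleRoot i) (simpleRoot j) = 2 := by simpa using hf
    refine isRootProduct_form_of_pair (D := fun u v ↦ u = v ∧ (u = 2 ∨ u = -2))
      ?_ ?_ ?_ ?_ ?_ hg hx hy <;> simp only [hf, IsRootProduct] <;> grind
  · replace hf : M.form (simpleRoot i) (simpleRoot j) = 0 := by simpa using hf
    refine isRootProduct_form_of_pair (D := fun u v ↦ (u = 2 ∧ v = 0) ∨ (u = -2 ∧ v = 0) ∨
      (u = 0 ∧ v = 2) ∨ (u = 0 ∧ v = -2)) ?_ ?_ ?_ ?_ ?_ hg hx hy <;>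
      simp only [hf, IsRootProduct] <;> grind
  · replace hf : M.form (simpleRoot i) (simpleRoot j) = -1 := by simpa using hf
    refine isRootProduct_form_of_pair (D := fun u v ↦ (u = 2 ∧ v = -1) ∨ (u = -2 ∧ v = 1) ∨
      (u = -1 ∧ v = 2) ∨ (u = 1 ∧ v = -2) ∨ (u = 1 ∧ v = 1) ∨ (u = -1 ∧ v = -1))
      ?_ ?_ ?_ ?_ ?_ hg hx hy <;> simp only [hf, IsRootProduct] <;> grind
  · replace hf : M.form (simpleRoot i) (simpleRoot j) = -√2 := by
      rw [hf, Nat.cast_ofNat, cos_pi_div_four]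
      ring
    refine isRootProduct_form_of_pair (D := fun u v ↦ (u = 2 ∧ v = -√2) ∨ (u = -2 ∧ v = √2) ∨
      (u = -√2 ∧ v = 2) ∨ (u = √2 ∧ v = -2) ∨ (u = 0 ∧ v = √2) ∨ (u = 0 ∧ v = -√2) ∨
      (u = √2 ∧ v = 0) ∨ (u = -√2 ∧ v = 0))
      ?_ ?_ ?_ ?_ ?_ hg hx hy <;> simp only [hf, IsRootProduct]
    all_goals
      clear hf
      generalize √2 = q, φ = p at *
    iterate 2
      · rintro u v (⟨rfl, rfl⟩ | ⟨rfl, rfl⟩ | ⟨rfl, rfl⟩ | ⟨rfl, rfl⟩ | ⟨rfl, rfl⟩ |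
          ⟨rfl, rfl⟩ | ⟨rfl, rfl⟩ | ⟨rfl, rfl⟩)
        all_goals grind
    all_goals grind
  · refine isRootProduct_form_of_eq_five ?_ hg hx hy
    rw [hf, Nat.cast_ofNat, cos_pi_div_five, goldenRatio]
    ring

theorem exists_subset_pair [Finite W] {S : Set B} {t t' : W} {γ γ' : B →₀ ℝ}
    (h : cs.HasRoot t γ) (h' : cs.HasRoot t' γ') (hγ : γ ∈ Finsupp.supported ℝ ℝ S)
    (hγ' : γ' ∈ Finsupp.supported ℝ ℝ S) : ∃ g ∈ cs.standardParabolic S, ∃ i ∈ S, ∃ j ∈ S,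
      cs.geomRep g γ ∈ Finsupp.supported ℝ ℝ {i, j} ∧
      cs.geomRep g γ' ∈ Finsupp.supported ℝ ℝ {i, j} := by
  have := cs.finite_index
  obtain ⟨v, hv, hgen⟩ := cs.exists_generic
    (LinearMap.ker (M.form.flip γ) ⊓ LinearMap.ker (M.form.flip γ'))
  obtain ⟨hvγ, hvγ'⟩ := hv
  rw [SetLike.mem_coe, LinearMap.mem_ker, LinearMap.flip_apply] at hvγ hvγ'
  obtain ⟨g, hg, hdom⟩ := cs.exists_dominant S v
  set J : Set B := {i ∈ S | M.form (cs.geomRep g v) (simpleRoot i) = 0} with hJ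
  have hJγ : cs.geomRep g γ ∈ Finsupp.supported ℝ ℝ J := by
    refine (h.conj g).mem_supported_of_form_eq_zero hdom (geomRep_mem_supported hg hγ) ?_
    rw [form_geomRep, hvγ]
  have hJγ' : cs.geomRep g γ' ∈ Finsupp.supported ℝ ℝ J := by
    refine (h'.conj g).mem_supported_of_form_eq_zero hdom (geomRep_mem_supported hg hγ') ?_
    rw [form_geomRep, hvγ']
  have hle : Finsupp.supported ℝ ℝ J ≤
      Submodule.span ℝ {x | x ∈ [cs.geomRep g γ, cs.geomRep g γ']} := by
    rw [Finsupp.supported_eq_span_single, Submodule.span_le]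
    rintro _ ⟨i, hi, rfl⟩
    change simpleRoot i ∈ _
    by_contra hnot
    obtain ⟨z, hz, hz0⟩ := cs.exists_form_eq_of_notMem hnot
    refine hz ?_
    rw [← geomRep_apply_inv_self cs g z, form_geomRep_left]
    refine hgen _ _ ((cs.hasRoot_simple i).conj g⁻¹) ?_ _ ⟨?_, ?_⟩
    · rw [← form_geomRep_left]
      exact hi.2
    · rw [SetLike.mem_coe, LinearMap.mem_ker, LinearMap.flip_apply, form_geomRep_left, inv_inv]
      exact hz0 _ (Submodule.subset_span (by simp))
    · rw [SetLike.mem_coe, LinearMap.mem_ker, LinearMap.flip_apply, form_geomRep_left, inv_inv]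
      exact hz0 _ (Submodule.subset_span (by simp))
  have hcard : J.ncard ≤ 2 := by
    have h₁ := (Submodule.finrank_mono hle).trans (finrank_span_le_length _)
    have := Fintype.ofFinite J
    rwa [(Finsupp.supportedEquivFinsupp (M := ℝ) (R := ℝ) J).finrank_eq,
      Module.finrank_finsupp_self, ← Nat.card_eq_fintype_card] at h₁
  have hne : J.ncard ≠ 0 := fun h0 ↦ by
    rw [Set.ncard_eq_zero] at h0
    rw [h0, Finsupp.supported_empty, Submodule.mem_bot] at hJγ
    exact (h.conj g).ne_zero hJγ
  have hpair : ∃ i j, J = {i, j} := by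
    rcases (by omega : J.ncard = 1 ∨ J.ncard = 2) with h1 | h2
    · obtain ⟨i, hi⟩ := Set.ncard_eq_one.mp h1
      exact ⟨i, i, by simpa using hi⟩
    · obtain ⟨i, j, -, hij⟩ := Set.ncard_eq_two.mp h2
      exact ⟨i, j, hij⟩
  obtain ⟨i, j, hij⟩ := hpair
  have hJS : J ⊆ S := fun i hi ↦ hi.1
  exact ⟨g, hg, i, hJS (by simp [hij]), j, hJS (by simp [hij]), hij ▸ hJγ, hij ▸ hJγ'⟩

/-- The inner products of the roots supported on `S`, if all bonds in `S` have label at most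
`5`. -/
theorem HasRoot.isRootProduct_form [Finite W] {S : Set B}
    (hS : ∀ i ∈ S, ∀ j ∈ S, M i j ≠ 0 ∧ M i j ≤ 5) {t t' : W} {γ γ' : B →₀ ℝ}
    (h : cs.HasRoot t γ) (h' : cs.HasRoot t' γ') (hγ : γ ∈ Finsupp.supported ℝ ℝ S)
    (hγ' : γ' ∈ Finsupp.supported ℝ ℝ S) : IsRootProduct (M.form γ γ') := by
  obtain ⟨g, -, i, hi, j, hj, hgγ, hgγ'⟩ := exists_subset_pair h h' hγ hγ'
  obtain ⟨a, ha, x, hx, -, hax⟩ := (h.conj g).exists_geomRep_simpleRoot_eq hgγ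
  obtain ⟨b, hb, y, hy, -, hby⟩ := (h'.conj g).exists_geomRep_simpleRoot_eq hgγ'
  rw [← cs.form_geomRep g, hax, hby, form_geomRep_left, ← geomRep_mul_apply]
  exact isRootProduct_form_geomRep (hS i hi j hj).1 (hS i hi j hj).2 (mul_mem (inv_mem ha) hb)
    hx hy

end CoxeterSystem

/-! ### Lattices over `ℤ[√2, φ]` -/

namespace CoxeterSystem

open CoxeterMatrix Module goldenRatio

variable {B W : Type*} [Group W] {M : CoxeterMatrix B} {cs : CoxeterSystem M W}

theorem eq_zero_of_sq_eq_mul_sq {n : ℕ} (hn : ¬IsSquare n) {x y : ℚ} (h : x ^ 2 = n * y ^ 2) :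
    x = 0 ∧ y = 0 := by
  have hy : y = 0 := by
    by_contra hy
    refine hn (Rat.isSquare_natCast_iff.mp ⟨x / y, ?_⟩)
    field_simp
    linarith
  subst hy
  simpa using h

/-- An additive functional on `ℝ` reading off the rational part of elements of `ℚ(√2, φ)`. -/
theorem exists_rational_part : ∃ f : ℝ →+ ℚ, f 1 = 1 ∧ f √2 = 0 ∧ f φ = 0 ∧ f (√2 * φ) = 0 := by
  have h1 : (1 : ℝ) ∉ Submodule.span ℚ {√2, φ, √2 * φ} := by
    intro h
    rw [Submodule.mem_span_triple] at h
    obtain ⟨a, b, c, h⟩ := h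
    simp only [Rat.smul_def, goldenRatio] at h
    have h2 : √2 ^ 2 = 2 := sq_sqrt two_pos.le
    have h5 : √5 ^ 2 = 5 := sq_sqrt (by norm_num)
    obtain ⟨p, hp⟩ : ∃ p : ℚ, p = 1 - b / 2 := ⟨_, rfl⟩
    obtain ⟨q, hq⟩ : ∃ q : ℚ, q = -(b / 2) := ⟨_, rfl⟩
    obtain ⟨r, hr⟩ : ∃ r : ℚ, r = a + c / 2 := ⟨_, rfl⟩
    obtain ⟨s, hs⟩ : ∃ s : ℚ, s = c / 2 := ⟨_, rfl⟩
    have hpq : (p : ℝ) + q * √5 = √2 * (r + s * √5) := by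
      rw [hp, hq, hr, hs]
      push_cast
      linear_combination -h
    have hsq : ((p ^ 2 + 5 * q ^ 2 - 2 * r ^ 2 - 10 * s ^ 2 : ℚ) : ℝ) =
        ((4 * r * s - 2 * p * q : ℚ) : ℝ) * √5 := by
      push_cast
      linear_combination ((p : ℝ) + q * √5 + √2 * (r + s * √5)) * hpq +
        ((r : ℝ) + s * √5) ^ 2 * h2 + (2 * (s : ℝ) ^ 2 - q ^ 2) * h5
    have hsq' : (p ^ 2 + 5 * q ^ 2 - 2 * r ^ 2 - 10 * s ^ 2) ^ 2 =
        (5 : ℕ) * (4 * r * s - 2 * p * q) ^ 2 := by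
      have : ((p ^ 2 + 5 * q ^ 2 - 2 * r ^ 2 - 10 * s ^ 2 : ℚ) : ℝ) ^ 2 =
        5 * ((4 * r * s - 2 * p * q : ℚ) : ℝ) ^ 2 := by rw [hsq, mul_pow, h5]; ring
      exact_mod_cast this
    obtain ⟨e₁, e₂⟩ := eq_zero_of_sq_eq_mul_sq (by decide +kernel) hsq'
    have hnorm : (p ^ 2 - 5 * q ^ 2 - 2 * (r ^ 2 - 5 * s ^ 2)) *
        (p ^ 2 - 5 * q ^ 2 + 2 * (r ^ 2 - 5 * s ^ 2)) = 0 := by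
      linear_combination (p ^ 2 + 5 * q ^ 2 + 2 * r ^ 2 + 10 * s ^ 2) * e₁ +
        5 * (4 * r * s + 2 * p * q) * e₂
    have hp0 : p = 0 ∧ q = 0 := by
      rcases mul_eq_zero.mp hnorm with h | h
      · exact ⟨(eq_zero_of_sq_eq_mul_sq (n := 2) (y := r) (by decide +kernel)
          (by push_cast; linarith)).1,
          (eq_zero_of_sq_eq_mul_sq (n := 2) (y := s) (by decide +kernel)
          (by push_cast; linarith)).1⟩
      · exact ⟨(eq_zero_of_sq_eq_mul_sq (n := 10) (y := s) (by decide +kernel)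
          (by push_cast; linarith)).1,
          (eq_zero_of_sq_eq_mul_sq (n := 10) (x := 2 * r) (by decide +kernel)
          (by push_cast; linarith)).2⟩
    linarith [hp0.1, hp0.2]
  obtain ⟨f, hf, hle⟩ := Submodule.exists_le_ker_of_notMem h1
  have hz : ∀ x ∈ ({√2, φ, √2 * φ} : Set ℝ), f x = 0 :=
    fun x hx ↦ hle (Submodule.subset_span hx)
  refine ⟨((f 1)⁻¹ • f).toAddMonoidHom, ?_, ?_, ?_, ?_⟩
  · simpa using inv_mul_cancel₀ hf
  · simp [hz √2]
  · simp [hz φ]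
  · simp [hz (√2 * φ)]

section Lattice

variable {V : Type*} [AddCommGroup V] [Module ℝ V] {b : V →ₗ[ℝ] V →ₗ[ℝ] ℝ} {X Φ : Set V}

/-- A reflection-stable set of vectors of norm `2` with root-like inner products. -/
structure IsRootLike (b : V →ₗ[ℝ] V →ₗ[ℝ] ℝ) (X : Set V) : Prop where
  comm : ∀ γ ∈ X, ∀ δ ∈ X, b γ δ = b δ γ
  self : ∀ γ ∈ X, b γ γ = 2
  prod : ∀ γ ∈ X, ∀ δ ∈ X, IsRootProduct (b γ δ)
  eq : ∀ γ ∈ X, ∀ δ ∈ X, b γ δ = 2 → γ = δ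
  refl : ∀ γ ∈ X, ∀ δ ∈ X, δ - b γ δ • γ ∈ X

theorem IsRootLike.neg_mem (h : IsRootLike b X) {γ : V} (hγ : γ ∈ X) : -γ ∈ X := by
  have := h.refl γ hγ γ hγ
  rw [h.self γ hγ] at this
  convert this using 1
  module

theorem rational_part_cases {f : ℝ →+ ℚ} (f1 : f 1 = 1) (f2 : f √2 = 0) (fφ : f φ = 0)
    (f2φ : f (√2 * φ) = 0) {η d c : ℝ} (hη : η = 1 ∨ η = φ)
    (hd : d = 1 ∨ d = √2 ∨ d = φ ∨ d = √2 * φ) (hc : IsRootProduct c) (h : 0 < f (η * (d * c))) :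
    c = 2 ∨ (η = 1 ∧ d = 1 ∧ (c = 1 ∨ c = 1 - φ)) ∨ (η = 1 ∧ d = φ ∧ (c = φ ∨ c = φ - 1)) ∨
      (η = 1 ∧ d = √2 ∧ c = √2) ∨ (η = φ ∧ d = 1 ∧ (c = φ ∨ c = φ - 1)) ∨
      (η = φ ∧ d = φ ∧ (c = 1 ∨ c = φ)) ∨ (η = φ ∧ d = √2 * φ ∧ c = √2) := by
  have hp : φ * φ = φ + 1 := by rw [← sq]; exact goldenRatio_sq
  have hq : √2 * √2 = 1 + 1 := by norm_num
  have h2 : (2 : ℝ) = 1 + 1 := by norm_num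
  simp only [IsRootProduct] at hc
  generalize √2 = q, φ = p at *
  have hqp : p * q = q * p := mul_comm p q
  have hqqp : q * (q * p) = p + p := by rw [← mul_assoc, hq]; ring
  have hpqp : p * (q * p) = q * p + q := by linear_combination q * hp
  rcases hη with rfl | rfl <;> rcases hd with rfl | rfl | rfl | rfl <;>
    rcases hc with rfl | rfl | rfl | rfl | rfl | rfl | rfl | rfl | rfl | rfl | rfl <;>
    first
    | simp only [true_and, and_true, true_or, or_true]; done
    | exfalso
      simp only [h2, mul_assoc, mul_add, mul_sub, mul_neg, mul_one, one_mul, mul_zero, hp, hq, hqp,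
        hqqp, hpqp, map_add, map_sub, map_neg, map_zero, f1, f2, fφ, f2φ] at h
      norm_num at h

theorem IsRootLike.exists_sub_eq (hX : IsRootLike b X) (hΦ : IsRootLike b Φ) (hΦX : Φ ⊆ X)
    {f : ℝ →+ ℚ} (f1 : f 1 = 1) (f2 : f √2 = 0) (fφ : f φ = 0) (f2φ : f (√2 * φ) = 0)
    {γ β : V} (hγ : γ ∈ X) (hβ : β ∈ Φ) {η d : ℝ} (hη : η = 1 ∨ η = φ)
    (hd : d = 1 ∨ d = √2 ∨ d = φ ∨ d = √2 * φ) (hpos : 0 < f (b (η • γ) (d • β))) :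
    γ ∈ Φ ∨ ∃ η' : ℝ, (η' = 1 ∨ η' = φ) ∧ ∃ δ ∈ X, η • γ - d • β = η' • δ ∧ (δ ∈ Φ → γ ∈ Φ) := by
  have hp : φ ^ 2 = φ + 1 := goldenRatio_sq
  have hq : √2 ^ 2 = 2 := sq_sqrt two_pos.le
  have hβX := hΦX hβ
  have hc := hX.prod β hβX γ hγ
  have heq := hX.eq β hβX γ hγ
  rw [LinearMap.map_smul, LinearMap.map_smul, LinearMap.smul_apply, smul_eq_mul, smul_eq_mul,
    hX.comm γ hγ β hβX, mul_left_comm] at hpos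
  have hcases := rational_part_cases f1 f2 fφ f2φ hη hd hc hpos
  have hsβ : β - b γ β • γ ∈ X := hX.refl γ hγ β hβX
  have hsγ : γ - b β γ • β ∈ X := hX.refl β hβX γ hγ
  have back (δ : V) (hδ : δ ∈ Φ) : δ - b β δ • β ∈ Φ := hΦ.refl β hβ δ hδ
  have back' (δ : V) (hδ : δ ∈ Φ) : β - b δ β • δ ∈ Φ := hΦ.refl δ hδ β hβ
  have hsγ' := hX.refl γ hγ _ hsγ
  have hββ := hX.self β hβX
  have hγγ := hX.self γ hγ
  have hγβ := hX.comm γ hγ β hβX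
  have hinv (h : γ - b β γ • β ∈ Φ) : γ ∈ Φ := by
    convert back _ h using 1
    simp only [map_sub, map_smul, smul_eq_mul, hββ]
    module
  simp only [map_sub, map_smul, smul_eq_mul, hγβ, hγγ] at hsβ hsγ'
  generalize φ = p at *
  rcases hcases with hc | ⟨e₁, e₂, hc | hc⟩ | ⟨e₁, e₂, hc | hc⟩ | ⟨e₁, e₂, hc⟩ |
    ⟨e₁, e₂, hc | hc⟩ | ⟨e₁, e₂, hc | hc⟩ | ⟨e₁, e₂, hc⟩
  · exact Or.inl (heq hc ▸ hβ)
  all_goals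
    right
    rw [e₁, e₂]
    rw [hc] at hγβ hsβ hsγ hsγ' hinv
  · exact ⟨1, Or.inl rfl, _, hsγ, by module, hinv⟩
  · refine ⟨p, Or.inr rfl, (p - 1) • (γ - β), ?_, ?_, fun h ↦ ?_⟩
    · convert hX.neg_mem hsγ' using 1
      match_scalars <;> grind
    · match_scalars <;> grind
    · convert back' _ h using 1
      simp only [map_sub, map_smul, smul_eq_mul, hββ, hγβ, LinearMap.sub_apply,
        LinearMap.smul_apply]
      match_scalars <;> grind
  · exact ⟨1, Or.inl rfl, _, hsγ, by module, hinv⟩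
  · refine ⟨p, Or.inr rfl, (p - 1) • γ - β, ?_, ?_, fun h ↦ ?_⟩
    · convert hX.neg_mem hsβ using 1
      module
    · match_scalars <;> grind
    · convert hΦ.refl _ h _ (back _ h) using 1
      simp only [map_sub, map_smul, smul_eq_mul, hββ, hγβ, hc, hγγ, LinearMap.sub_apply,
        LinearMap.smul_apply]
      match_scalars <;> grind
  · exact ⟨1, Or.inl rfl, _, hsγ, by module, hinv⟩
  · refine ⟨1, Or.inl rfl, p • γ - β, ?_, by module, fun h ↦ ?_⟩
    · convert hX.neg_mem hsβ using 1
      module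
    · convert hΦ.neg_mem (back _ (back' _ h)) using 1
      simp only [map_sub, map_smul, smul_eq_mul, hββ, hγβ, hc, LinearMap.sub_apply,
        LinearMap.smul_apply]
      match_scalars <;> grind
  · refine ⟨p, Or.inr rfl, _, hsγ, ?_, hinv⟩
    match_scalars <;> grind
  · exact ⟨p, Or.inr rfl, _, hsγ, by module, hinv⟩
  · refine ⟨1, Or.inl rfl, p • (γ - β), ?_, by module, fun h ↦ ?_⟩
    · convert hsγ' using 1
      match_scalars <;> grind
    · convert back' _ h using 1
      simp only [map_sub, map_smul, smul_eq_mul, hββ, hγβ, LinearMap.sub_apply,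
        LinearMap.smul_apply]
      match_scalars <;> grind
  · exact ⟨p, Or.inr rfl, _, hsγ, by module, hinv⟩

/-- The multiples of elements of `Φ` used to span lattices over `ℤ[√2, φ]`. -/
def scaledRoots (Φ : Set V) : Set V :=
  {v | ∃ d : ℝ, (d = 1 ∨ d = √2 ∨ d = φ ∨ d = √2 * φ) ∧ ∃ β ∈ Φ, v = d • β}

theorem IsRootLike.mem_of_sum_eq (hX : IsRootLike b X) (hΦ : IsRootLike b Φ) (hΦX : Φ ⊆ X)
    (n : ℕ) : ∀ L : List V, L.length = n → (∀ v ∈ L, v ∈ scaledRoots Φ) → ∀ η : ℝ,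
      (η = 1 ∨ η = φ) → ∀ γ ∈ X, L.sum = η • γ → γ ∈ Φ := by
  obtain ⟨f, f1, f2, fφ, f2φ⟩ := exists_rational_part
  induction n with
  | zero =>
    intro L hL _ η hη γ hγ hsum
    rw [List.eq_nil_of_length_eq_zero hL, List.sum_nil] at hsum
    have h0 : η ≠ 0 := by
      rcases hη with rfl | rfl
      · exact one_ne_zero
      · exact goldenRatio_pos.ne'
    have := hX.self γ hγ
    rw [(smul_eq_zero.mp hsum.symm).resolve_left h0] at this
    simp at this
  | succ n ih =>
    intro L hL hv η hη γ hγ hsum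
    have hpos : 0 < f (b (η • γ) (η • γ)) := by
      rw [LinearMap.map_smul, LinearMap.map_smul, LinearMap.smul_apply, hX.self γ hγ]
      rcases hη with rfl | rfl
      · have : (1 : ℝ) • (1 : ℝ) • (2 : ℝ) = 1 + 1 := by norm_num
        rw [this, map_add, f1]
        norm_num
      · have : φ • φ • (2 : ℝ) = φ + φ + 1 + 1 := by
          rw [smul_eq_mul, smul_eq_mul]
          linear_combination 2 * goldenRatio_sq
        rw [this, map_add, map_add, map_add, f1, fφ]
        norm_num
    obtain ⟨v, hvL, hvpos⟩ : ∃ v ∈ L, 0 < f (b (η • γ) v) := by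
      by_contra! hle
      rw [← hsum] at hpos
      rw [← hsum] at hle
      generalize b L.sum = g at hle hpos
      refine hpos.not_ge ?_
      clear hL hv hsum hpos
      induction L with
      | nil => simp
      | cons v L ihL =>
        rw [List.sum_cons, map_add, map_add]
        exact add_nonpos (hle v (by simp)) (ihL fun u hu ↦ hle u (by simp [hu]))
    obtain ⟨d, hd, β, hβ, rfl⟩ := hv v hvL
    rcases hX.exists_sub_eq hΦ hΦX f1 f2 fφ f2φ hγ hβ hη hd hvpos with h |
      ⟨η', hη', δ, hδ, hsub, himp⟩
    · exact h
    · obtain ⟨L₁, L₂, rfl⟩ := List.append_of_mem hvL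
      refine himp (ih (L₁ ++ L₂) ?_ (fun v hv' ↦ hv v ?_) η' hη' δ hδ ?_)
      · simp only [List.length_append, List.length_cons] at hL ⊢
        omega
      · simp only [List.mem_append, List.mem_cons] at hv' ⊢
        tauto
      · rw [← hsub, ← hsum]
        simp only [List.sum_append, List.sum_cons]
        abel

/-- The ring `ℤ[√2, φ]`. -/
def rootRing : Subring ℝ := Subring.closure {√2, φ}

theorem IsRootProduct.mem_rootRing {x : ℝ} (hx : IsRootProduct x) : x ∈ rootRing := by
  have h2 : √2 ∈ rootRing := Subring.subset_closure (by simp)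
  have hφ : φ ∈ rootRing := Subring.subset_closure (by simp)
  have h2' : (2 : ℝ) ∈ rootRing := by
    rw [← one_add_one_eq_two]
    exact add_mem (one_mem _) (one_mem _)
  rcases hx with rfl | rfl | rfl | rfl | rfl | rfl | rfl | rfl | rfl | rfl | rfl
  exacts [zero_mem _, one_mem _, neg_mem (one_mem _), h2, neg_mem h2, hφ, neg_mem hφ,
    sub_mem hφ (one_mem _), sub_mem (one_mem _) hφ, h2', neg_mem h2']

theorem span_rootRing_le {G : Set V} (hΦneg : ∀ γ ∈ Φ, -γ ∈ Φ) (hG : G ⊆ Φ) {x : V}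
    (hx : x ∈ Submodule.span rootRing G) : x ∈ AddSubmonoid.closure (scaledRoots Φ) := by
  have hp : φ ^ 2 = φ + 1 := goldenRatio_sq
  have hq : √2 ^ 2 = 2 := sq_sqrt two_pos.le
  have mem {d : ℝ} (hd : d = 1 ∨ d = √2 ∨ d = φ ∨ d = √2 * φ) {β : V} (hβ : β ∈ Φ) :
      d • β ∈ AddSubmonoid.closure (scaledRoots Φ) :=
    AddSubmonoid.subset_closure ⟨d, hd, β, hβ, rfl⟩
  have extend (c : ℝ) (hc : ∀ d : ℝ, (d = 1 ∨ d = √2 ∨ d = φ ∨ d = √2 * φ) → ∀ β ∈ Φ,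
      c • d • β ∈ AddSubmonoid.closure (scaledRoots Φ)) :
      ∀ y ∈ AddSubmonoid.closure (scaledRoots Φ),
        c • y ∈ AddSubmonoid.closure (scaledRoots Φ) := by
    intro y hy
    induction hy using AddSubmonoid.closure_induction with
    | mem y hy =>
      obtain ⟨d, hd, β, hβ, rfl⟩ := hy
      exact hc d hd β hβ
    | zero => rw [smul_zero]; exact zero_mem _
    | add y z _ _ hy hz => rw [smul_add]; exact add_mem hy hz
  have hsqrt := extend √2 fun d hd β hβ ↦ by
    rcases hd with rfl | rfl | rfl | rfl
    · rw [one_smul]; exact mem (by simp) hβ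
    · convert add_mem (mem (Or.inl rfl) hβ) (mem (Or.inl rfl) hβ) using 1
      match_scalars
      linear_combination hq
    · rw [smul_smul]; exact mem (by simp) hβ
    · convert add_mem (mem (d := φ) (by simp) hβ) (mem (d := φ) (by simp) hβ) using 1
      match_scalars
      linear_combination φ * hq
  have hgold := extend φ fun d hd β hβ ↦ by
    rcases hd with rfl | rfl | rfl | rfl
    · rw [one_smul]; exact mem (by simp) hβ
    · rw [smul_smul, mul_comm]; exact mem (by simp) hβ
    · convert add_mem (mem (d := φ) (by simp) hβ) (mem (Or.inl rfl) hβ) using 1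
      rw [smul_smul, ← sq, hp]
      module
    · convert add_mem (mem (d := √2 * φ) (by simp) hβ) (mem (d := √2) (by simp) hβ) using 1
      rw [smul_smul, mul_left_comm, ← sq, hp]
      module
  have hneg := extend (-1) fun d hd β hβ ↦ by
    rw [smul_comm, neg_one_smul]
    exact mem hd (hΦneg β hβ)
  have hsmul : ∀ r ∈ rootRing, ∀ y ∈ AddSubmonoid.closure (scaledRoots Φ),
      r • y ∈ AddSubmonoid.closure (scaledRoots Φ) := by
    intro r hr
    induction hr using Subring.closure_induction with
    | mem r hr =>
      rcases hr with rfl | rfl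
      exacts [hsqrt, hgold]
    | zero => intro y _; rw [zero_smul]; exact zero_mem _
    | one => intro y hy; rwa [one_smul]
    | add r s _ _ hr hs => intro y hy; rw [add_smul]; exact add_mem (hr y hy) (hs y hy)
    | neg r _ hr => intro y hy; rw [neg_smul, ← neg_one_smul ℝ]; exact hneg _ (hr y hy)
    | mul r s _ _ hr hs => intro y hy; rw [mul_smul]; exact hr _ (hs y hy)
  induction hx using Submodule.span_induction with
  | mem y hy => simpa using mem (Or.inl rfl) (hG hy)
  | zero => exact zero_mem _
  | add y z _ _ hy hz => exact add_mem hy hz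
  | smul r y _ hy => exact hsmul r r.2 y hy

theorem IsRootLike.mem_of_mem_span (hX : IsRootLike b X) (hΦ : IsRootLike b Φ) (hΦX : Φ ⊆ X)
    {G : Set V} (hG : G ⊆ Φ) {γ : V} (hγ : γ ∈ X) (h : γ ∈ Submodule.span rootRing G) : γ ∈ Φ := by
  obtain ⟨L, hL, hsum⟩ := AddSubmonoid.exists_list_of_mem_closure
    (span_rootRing_le (fun γ hγ ↦ hΦ.neg_mem hγ) hG h)
  exact hX.mem_of_sum_eq hΦ hΦX _ L rfl hL 1 (Or.inl rfl) γ hγ (by rw [hsum, one_smul])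

end Lattice

end CoxeterSystem

/-! ### Bonds with labels at most five -/

namespace CoxeterSystem

open CoxeterMatrix Module

variable {B W : Type*} [Group W] {M : CoxeterMatrix B} {cs : CoxeterSystem M W}

section IntegralSpan

variable {A : Subring ℝ} {G : Set (B →₀ ℝ)} {T : Set W}

theorem form_mem_of_mem_span {γ y : B →₀ ℝ} (hG : ∀ δ ∈ G, M.form δ γ ∈ A)
    (hy : y ∈ Submodule.span A G) : M.form y γ ∈ A := by
  induction hy using Submodule.span_induction with
  | mem y hy => exact hG y hy
  | zero => simp
  | add y z _ _ hy hz =>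
    rw [map_add, LinearMap.add_apply]
    exact add_mem hy hz
  | smul r y _ hy =>
    rw [Subring.smul_def, map_smul, LinearMap.smul_apply]
    exact mul_mem r.2 hy

theorem geomRep_sub_mem_span (hT : ∀ t ∈ T, ∃ γ ∈ G, cs.HasRoot t γ)
    (hG : ∀ γ ∈ G, ∀ δ ∈ G, M.form γ δ ∈ A) {x : B →₀ ℝ} (hx : ∀ γ ∈ G, M.form x γ ∈ A) {g : W}
    (hg : g ∈ Subgroup.closure T) : cs.geomRep g x - x ∈ Submodule.span A G := by
  have step : ∀ y : B →₀ ℝ, y - x ∈ Submodule.span A G → ∀ t ∈ T,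
      cs.geomRep t y - x ∈ Submodule.span A G := by
    intro y hy t ht
    obtain ⟨γ, hγ, h⟩ := hT t ht
    have hyγ : M.form y γ ∈ A := by
      have := add_mem (form_mem_of_mem_span (fun δ hδ ↦ hG δ hδ γ hγ) hy) (hx γ hγ)
      rwa [map_sub, LinearMap.sub_apply, sub_add_cancel] at this
    rw [h.geomRep_apply, sub_right_comm]
    exact sub_mem hy (Submodule.smul_mem _ (⟨_, hyγ⟩ : A) (Submodule.subset_span hγ))
  induction hg using Subgroup.closure_induction_left with
  | one => simp
  | mul_left t ht y _ ih =>
    rw [geomRep_mul_apply]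
    exact step _ ih t ht
  | inv_mul_cancel t ht y _ ih =>
    obtain ⟨γ, -, h⟩ := hT t ht
    rw [h.inv, geomRep_mul_apply]
    exact step _ ih t ht

theorem geomRep_mem_span (hT : ∀ t ∈ T, ∃ γ ∈ G, cs.HasRoot t γ)
    (hG : ∀ γ ∈ G, ∀ δ ∈ G, M.form γ δ ∈ A) {x : B →₀ ℝ} (hx : x ∈ Submodule.span A G) {g : W}
    (hg : g ∈ Subgroup.closure T) : cs.geomRep g x ∈ Submodule.span A G := by
  have := add_mem (geomRep_sub_mem_span hT hG
    (fun γ hγ ↦ form_mem_of_mem_span (fun δ hδ ↦ hG δ hδ γ hγ) hx) hg) hx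
  rwa [sub_add_cancel] at this

theorem exists_sub_geomRep_prod_eq [Finite W] {l : List W} {R : List (B →₀ ℝ)}
    (hR : List.Forall₂ cs.HasRoot l R) (hind : IndepList R)
    (hA : ∀ γ ∈ R, ∀ δ ∈ R, M.form γ δ ∈ A) {y : B →₀ ℝ}
    (hy : y ∈ Submodule.span A {x | x ∈ R}) :
    ∃ x, (∀ γ ∈ R, M.form x γ ∈ A) ∧ x - cs.geomRep l.prod x = y := by
  induction hR generalizing y with
  | nil =>
    have hy0 : y = 0 := by simpa using hy
    exact ⟨0, by simp, by simp [hy0]⟩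
  | @cons t a l R ht hR ih =>
    have hset : {x | x ∈ a :: R} = insert a {x | x ∈ R} := by ext; simp
    rw [hset, Submodule.mem_span_insert] at hy
    obtain ⟨c, y', hy', rfl⟩ := hy
    obtain ⟨x', hx', hxy'⟩ := ih hind.2 (fun γ hγ δ hδ ↦ hA γ (.tail _ hγ) δ (.tail _ hδ)) hy'
    obtain ⟨z, hza, hz⟩ := cs.exists_form_eq_of_notMem hind.1
    obtain ⟨k, hk⟩ : ∃ k : ℝ, k * M.form z a = c - M.form (cs.geomRep l.prod x') a :=
      ⟨_, div_mul_cancel₀ _ hza⟩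
    have hfix : cs.geomRep l.prod (k • z) = k • z := by
      refine geomRep_eq_self_of_orthogonal (T := {t | t ∈ l}) (fun u hu ↦ ?_) (prod_mem_closure l)
      obtain ⟨γ, hγ, h⟩ := exists_hasRoot_of_forall₂ hR hu
      exact ⟨γ, by simp [hz γ (Submodule.subset_span hγ)], h⟩
    have hform : M.form (cs.geomRep l.prod x' + k • z) a = c := by
      rw [map_add, LinearMap.add_apply, map_smul, LinearMap.smul_apply, smul_eq_mul, hk]
      ring
    have hx'w : x' = cs.geomRep l.prod x' + y' := by rw [← hxy']; abel
    refine ⟨x' + k • z, fun γ hγ ↦ ?_, ?_⟩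
    · rcases List.mem_cons.mp hγ with rfl | hγ
      · rw [hx'w, add_right_comm, map_add, LinearMap.add_apply, hform]
        exact add_mem c.2 (form_mem_of_mem_span
          (fun δ hδ ↦ hA δ (.tail _ hδ) γ List.mem_cons_self) hy')
      · rw [map_add, LinearMap.add_apply, map_smul, LinearMap.smul_apply,
          hz γ (Submodule.subset_span hγ), smul_zero, add_zero]
        exact hx' γ hγ
    · rw [List.prod_cons, geomRep_mul_apply, map_add, hfix, ht.geomRep_apply, hform, ← hxy',
        Subring.smul_def]
      abel

end IntegralSpan

theorem isRootLike_roots [Finite W] {S : Set B} (hS : ∀ i ∈ S, ∀ j ∈ S, M i j ≠ 0 ∧ M i j ≤ 5)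
    (H : Subgroup W) :
    IsRootLike M.form {γ | γ ∈ Finsupp.supported ℝ ℝ S ∧ ∃ t ∈ H, cs.HasRoot t γ} where
  comm γ _ δ _ := M.form_comm γ δ
  self := by
    rintro γ ⟨-, t, -, h⟩
    exact h.form_self
  prod := by
    rintro γ ⟨hγ, t, -, h⟩ δ ⟨hδ, t', -, h'⟩
    exact h.isRootProduct_form hS h' hγ hδ
  eq := by
    rintro γ ⟨hγ, t, -, h⟩ δ ⟨hδ, t', -, h'⟩ heq
    refine sub_eq_zero.mp (cs.eq_zero_of_form_self ?_)
    simp only [map_sub, LinearMap.sub_apply, h.form_self, h'.form_self, M.form_comm δ γ, heq]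
    ring
  refl := by
    rintro γ ⟨hγ, t, ht, h⟩ δ ⟨hδ, t', ht', h'⟩
    refine ⟨sub_mem hδ (Submodule.smul_mem _ _ hγ), t * t' * t⁻¹,
      mul_mem (mul_mem ht ht') (inv_mem ht), ?_⟩
    have := h'.conj t
    rwa [h.geomRep_apply, M.form_comm] at this

theorem IsBasisFactorization.mem_supported {S : Set B} {w : W} {l : List W} {R : List (B →₀ ℝ)}
    (h : cs.IsBasisFactorization S w l R) {γ : B →₀ ℝ} (hγ : γ ∈ R) :
    γ ∈ Finsupp.supported ℝ ℝ S := h.span_eq ▸ Submodule.subset_span hγ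

theorem IsBasisFactorization.form_mem [Finite W] {S : Set B}
    (hS : ∀ i ∈ S, ∀ j ∈ S, M i j ≠ 0 ∧ M i j ≤ 5) {w : W} {l : List W} {R : List (B →₀ ℝ)}
    (h : cs.IsBasisFactorization S w l R) :
    ∀ γ ∈ R, ∀ δ ∈ R, M.form γ δ ∈ rootRing := fun γ hγ δ hδ ↦ by
  obtain ⟨t, -, ht⟩ := exists_mem_of_forall₂ h.hasRoot hγ
  obtain ⟨u, -, hu⟩ := exists_mem_of_forall₂ h.hasRoot hδ
  exact (ht.isRootProduct_form hS hu (h.mem_supported hγ) (h.mem_supported hδ)).mem_rootRing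

theorem IsBasisFactorization.mem_span_rootRing [Finite W] {S : Set B}
    (hS : ∀ i ∈ S, ∀ j ∈ S, M i j ≠ 0 ∧ M i j ≤ 5) {w : W} {l : List W} {R : List (B →₀ ℝ)}
    (h : cs.IsBasisFactorization S w l R)
    (hl : Subgroup.closure {t | t ∈ l} = cs.standardParabolic S) {t : W} {γ : B →₀ ℝ}
    (hγ : cs.HasRoot t γ) (hγS : γ ∈ Finsupp.supported ℝ ℝ S) :
    γ ∈ Submodule.span rootRing {x | x ∈ R} := by
  obtain ⟨g, hg, u, hu, rfl⟩ := hγ.isReflection.exists_conj_of_mem_closure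
    (T := {t | t ∈ l})
    (fun t ht ↦ (exists_hasRoot_of_forall₂ h.hasRoot ht).choose_spec.2.isReflection)
    (hl ▸ hγ.mem_standardParabolic hγS)
  obtain ⟨δ, hδ, hu⟩ := exists_hasRoot_of_forall₂ h.hasRoot hu
  have hmem : cs.geomRep g δ ∈ Submodule.span rootRing {x | x ∈ R} :=
    geomRep_mem_span (fun t ht ↦ exists_hasRoot_of_forall₂ h.hasRoot ht) (h.form_mem hS)
      (Submodule.subset_span hδ) hg
  rcases (hu.conj g).eq_or_eq_neg hγ with h | h
  · rwa [h]
  · rw [h]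
    exact neg_mem hmem

theorem generationTransfers_of_le_five [Finite W] (cs : CoxeterSystem M W) {S : Set B}
    (hS : ∀ i ∈ S, ∀ j ∈ S, M i j ≠ 0 ∧ M i j ≤ 5) : cs.GenerationTransfers S := by
  intro w l R l' R' h h' hl
  have hR' : {x | x ∈ R'} ⊆ {γ | γ ∈ Finsupp.supported ℝ ℝ S ∧
      ∃ t ∈ Subgroup.closure {t | t ∈ l'}, cs.HasRoot t γ} := fun γ hγ ↦ by
    obtain ⟨t, ht, hroot⟩ := exists_mem_of_forall₂ h'.hasRoot hγ
    exact ⟨h'.mem_supported hγ, t, Subgroup.subset_closure ht, hroot⟩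
  refine (Subgroup.closure_le _).mpr ?_
  rintro _ ⟨i, hi, rfl⟩
  have hiS : simpleRoot i ∈ Finsupp.supported ℝ ℝ S := simpleRoot_mem_supported hi
  obtain ⟨x, hx, hxi⟩ := exists_sub_geomRep_prod_eq h.hasRoot h.indep (h.form_mem hS)
    (h.mem_span_rootRing hS hl (cs.hasRoot_simple i) hiS)
  have hx' : ∀ γ ∈ R', M.form x γ ∈ rootRing := fun γ hγ ↦ by
    obtain ⟨hγS, t, -, hroot⟩ := hR' hγ
    rw [M.form_comm]
    exact form_mem_of_mem_span (fun δ hδ ↦ M.form_comm x δ ▸ hx δ hδ)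
      (h.mem_span_rootRing hS hl hroot hγS)
  have hmem : simpleRoot i ∈ Submodule.span rootRing {x | x ∈ R'} := by
    rw [← hxi, ← neg_sub, h.prod_eq, ← h'.prod_eq]
    exact neg_mem (geomRep_sub_mem_span
      (fun t ht ↦ exists_hasRoot_of_forall₂ h'.hasRoot ht) (h'.form_mem hS) hx'
      (prod_mem_closure l'))
  obtain ⟨-, t, ht, hroot⟩ := (isRootLike_roots hS ⊤).mem_of_mem_span
    (isRootLike_roots hS (Subgroup.closure {t | t ∈ l'}))
    (fun γ ⟨hγ, t, _, ht⟩ ↦ ⟨hγ, t, Subgroup.mem_top t, ht⟩) hR'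
    ⟨hiS, _, Subgroup.mem_top _, cs.hasRoot_simple i⟩ hmem
  exact (cs.hasRoot_simple i).unique hroot ▸ ht

end CoxeterSystem

/-! ### The general case -/

namespace CoxeterSystem

open CoxeterMatrix Module

variable {B W : Type*} [Group W] {M : CoxeterMatrix B} {cs : CoxeterSystem M W}

theorem form_simpleRoot_nonpos {i j : B} (hij : i ≠ j) :
    M.form (simpleRoot i) (simpleRoot j) ≤ 0 := by
  rw [M.form_simpleRoot, neg_nonpos]
  refine mul_nonneg zero_le_two (cos_nonneg_of_mem_Icc ⟨?_, ?_⟩)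
  · have : 0 ≤ π / M i j := by positivity
    linarith [pi_pos]
  · rcases Nat.eq_zero_or_pos (M i j) with h0 | h0
    · rw [h0, Nat.cast_zero, div_zero]
      positivity
    · have h1 := M.off_diagonal i j hij
      have : (2 : ℝ) ≤ M i j := by exact_mod_cast (by omega : 2 ≤ M i j)
      exact div_le_div_of_nonneg_left pi_pos.le two_pos this

theorem form_simpleRoot_le_neg_one {i j : B} (hij : i ≠ j)
    (h : M.form (simpleRoot i) (simpleRoot j) ≠ 0) :
    M.form (simpleRoot i) (simpleRoot j) ≤ -1 := by
  have h1 := M.off_diagonal i j hij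
  have h2 : M i j ≠ 2 := fun h2 ↦ h (by simp [M.form_simpleRoot, h2])
  rw [M.form_simpleRoot]
  have : 1 / 2 ≤ cos (π / M i j) := by
    rcases Nat.eq_zero_or_pos (M i j) with h0 | h0
    · rw [h0, Nat.cast_zero, div_zero, cos_zero]
      norm_num
    · have h3 : (3 : ℝ) ≤ M i j := by exact_mod_cast (by omega : 3 ≤ M i j)
      rw [← cos_pi_div_three]
      exact cos_le_cos_of_nonneg_of_le_pi (by positivity) (by linarith [pi_pos])
        (div_le_div_of_nonneg_left pi_pos.le three_pos h3)
  linarith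

theorem form_simpleRoot_le_neg_sqrt_three {i j : B} (hM : ¬(M i j ≠ 0 ∧ M i j ≤ 5)) :
    M.form (simpleRoot i) (simpleRoot j) ≤ -√3 := by
  rw [M.form_simpleRoot]
  have : √3 / 2 ≤ cos (π / M i j) := by
    rw [← cos_pi_div_six]
    have h6 : π / M i j ≤ π / 6 := by
      rcases Nat.eq_zero_or_pos (M i j) with h0 | h0
      · rw [h0, Nat.cast_zero, div_zero]
        positivity
      · have h3 : (6 : ℝ) ≤ M i j := by exact_mod_cast (by omega : 6 ≤ M i j)
        exact div_le_div_of_nonneg_left pi_pos.le (by norm_num) h3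
    exact cos_le_cos_of_nonneg_of_le_pi (by positivity) (by linarith [pi_pos]) h6
  linarith

/-- In a finite Coxeter group, a bond with label at least `6` is an isolated component of the
Coxeter diagram. -/
theorem form_simpleRoot_eq_zero_of_bond [Finite W] (cs : CoxeterSystem M W) {i j k : B}
    (hM : ¬(M i j ≠ 0 ∧ M i j ≤ 5)) (hki : k ≠ i) (hkj : k ≠ j) :
    M.form (simpleRoot k) (simpleRoot i) = 0 := by
  by_contra hne
  have h₁ := form_simpleRoot_le_neg_one hki hne
  have h₂ := form_simpleRoot_nonpos (M := M) hkj
  have h₃ := form_simpleRoot_le_neg_sqrt_three hM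
  have h3 : √3 ^ 2 = 3 := sq_sqrt (by norm_num)
  have hpos : 0 < √3 := by positivity
  have hx : (simpleRoot k + (2 : ℝ) • simpleRoot i + √3 • simpleRoot j : B →₀ ℝ) ≠ 0 := by
    intro h0
    have := DFunLike.congr_fun h0 k
    simp [simpleRoot, hki.symm, hkj.symm] at this
  have := cs.form_self_pos hx
  simp only [map_add, map_smul, LinearMap.add_apply, LinearMap.smul_apply, smul_eq_mul,
    M.form_simpleRoot_self, M.form_comm (simpleRoot i) (simpleRoot k),
    M.form_comm (simpleRoot j) (simpleRoot k), M.form_comm (simpleRoot j) (simpleRoot i)] at this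
  nlinarith [mul_le_mul_of_nonneg_left h₃ hpos.le, mul_nonneg hpos.le (neg_nonneg.mpr h₂)]

theorem generationTransfers [Finite W] (cs : CoxeterSystem M W) (S : Set B) :
    cs.GenerationTransfers S := by
  have := cs.finite_index
  induction hn : S.ncard using Nat.strong_induction_on generalizing S with
  | _ n ih =>
  by_cases hS : ∀ i ∈ S, ∀ j ∈ S, M i j ≠ 0 ∧ M i j ≤ 5
  · exact cs.generationTransfers_of_le_five hS
  · push Not at hS
    obtain ⟨i, hi, j, hj, hM⟩ := hS
    have hM' : ¬(M i j ≠ 0 ∧ M i j ≤ 5) := fun h ↦ (hM h.1).not_ge h.2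
    have hM'' : ¬(M j i ≠ 0 ∧ M j i ≤ 5) := by rwa [M.symmetric j i]
    have hij : i ≠ j := by
      rintro rfl
      simp at hM'
    have hunion : {i, j} ∪ S \ {i, j} = S :=
      Set.union_sdiff_cancel (by rintro _ (rfl | rfl) <;> assumption)
    rw [← hunion]
    refine GenerationTransfers.union ?_ Set.disjoint_sdiff_right (generationTransfers_pair cs hij)
      (ih _ ?_ _ rfl)
    · rintro c hc k ⟨-, hk⟩
      simp only [Set.mem_insert_iff, Set.mem_singleton_iff, not_or] at hk
      rw [M.form_comm]
      rcases hc with rfl | rfl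
      · exact form_simpleRoot_eq_zero_of_bond cs hM' hk.1 hk.2
      · exact form_simpleRoot_eq_zero_of_bond cs hM'' hk.2 hk.1
    · rw [← hn]
      exact Set.ncard_lt_ncard ⟨Set.sdiff_subset, fun h ↦ (h hi).2 (by simp)⟩

/-- If a reflection factorization of length at most the dimension of the moved space generates a
standard parabolic subgroup, then so does every other one. -/
theorem standardParabolic_eq_of_length_le [Finite W] {S : Set B} {l l' : List W}
    (hl : ∀ t ∈ l, cs.IsReflection t) (hl' : ∀ t ∈ l', cs.IsReflection t)
    (hprod : l'.prod = l.prod) (hlen : l.length ≤ finrank ℝ (cs.movedSpace l.prod))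
    (hlen' : l'.length ≤ finrank ℝ (cs.movedSpace l.prod))
    (hgen : Subgroup.closure {t | t ∈ l} = cs.standardParabolic S) :
    Subgroup.closure {t | t ∈ l'} = cs.standardParabolic S := by
  obtain ⟨R, hR⟩ := exists_hasRoot_list hl
  obtain ⟨R', hR'⟩ := exists_hasRoot_list hl'
  obtain ⟨hind, hspan⟩ := span_eq_movedSpace hR hlen
  obtain ⟨hind', hspan'⟩ := span_eq_movedSpace hR' (hprod ▸ hlen')
  have hS : Submodule.span ℝ {x | x ∈ R} = Finsupp.supported ℝ ℝ S := by
    refine le_antisymm (Submodule.span_le.mpr fun γ hγ ↦ ?_) ?_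
    · obtain ⟨t, ht, h⟩ := exists_mem_of_forall₂ hR hγ
      exact h.mem_of_mem_closure (exists_hasRoot_supported S)
        (hgen.le (Subgroup.subset_closure ht))
    · rw [Finsupp.supported_eq_span_single, Submodule.span_le]
      rintro _ ⟨i, hi, rfl⟩
      exact (cs.hasRoot_simple i).mem_of_mem_closure (exists_hasRoot_span hR)
        (hgen.ge (simple_mem_standardParabolic hi))
  have hS' : Submodule.span ℝ {x | x ∈ R'} = Finsupp.supported ℝ ℝ S := by
    rw [hspan', hprod, ← hspan, hS]
  refine le_antisymm ((Subgroup.closure_le _).mpr fun t ht ↦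
    forall_mem_standardParabolic hR' hS'.le ht) ?_
  exact cs.generationTransfers S ⟨hR, hind, hS, rfl⟩ ⟨hR', hind', hS', hprod⟩ hgen

theorem forall_isReflection_map_conj {l : List W} (hl : ∀ t ∈ l, cs.IsReflection t) (u : W) :
    ∀ t ∈ l.map (MulAut.conj u), cs.IsReflection t := by
  simp only [List.mem_map]
  rintro _ ⟨t, ht, rfl⟩
  exact (hl t ht).conj u

theorem closure_map_conj (l : List W) (u : W) : Subgroup.closure {t | t ∈ l.map (MulAut.conj u)} =
    (Subgroup.closure {t | t ∈ l}).map (MulAut.conj u).toMonoidHom := by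
  rw [MonoidHom.map_closure]
  congr 1
  ext t
  simp

theorem length_le_finrank_movedSpace_conj [Finite W] {w : W} {l : List W} (hl : l ∈ RedT cs w)
    (u : W) : l.length ≤ finrank ℝ (cs.movedSpace (MulAut.conj u w)) := by
  obtain ⟨l₀, hl₀, hprod, hlen⟩ := cs.exists_prod_eq_of_finrank_movedSpace (MulAut.conj u w)
  refine (hl.1.le.trans (Nat.sInf_le ⟨l₀.map (MulAut.conj u⁻¹), rfl,
    forall_isReflection_map_conj hl₀ u⁻¹, ?_⟩)).trans ((List.length_map _).trans_le hlen)
  rw [← map_list_prod, hprod]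
  simp [mul_assoc]

end CoxeterSystem

end

/-- Let `(W, S)` be a finite (spherical) Coxeter system and `w ∈ W`.  If some reduced
reflection factorization of `w` generates a parabolic subgroup `P` of `W`, then every
reduced reflection factorization of `w` generates `P`. -/
theorem redT_generates_same_parabolic
    {B W : Type*} [Group W] [Finite W] {M : CoxeterMatrix B} (cs : CoxeterSystem M W)
    (w : W) (P : Subgroup W) (hP : IsParabolic cs P)
    (l : List W) (hl : l ∈ RedT cs w) (hgen : Subgroup.closure {t | t ∈ l} = P) :
    ∀ l' ∈ RedT cs w, Subgroup.closure {t | t ∈ l'} = P := by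
  obtain ⟨u, S, rfl⟩ := hP
  have hinv (H : Subgroup W) : (H.map (MulAut.conj u).toMonoidHom).map
      (MulAut.conj u⁻¹).toMonoidHom = H := by
    ext x
    simp [Subgroup.mem_map, mul_assoc]
  intro l' hl'
  refine Subgroup.map_injective (f := (MulAut.conj u⁻¹).toMonoidHom) (MulAut.conj u⁻¹).injective ?_
  have hprod (k : List W) (hk : k ∈ RedT cs w) :
      (k.map (MulAut.conj u⁻¹)).prod = MulAut.conj u⁻¹ w := by
    rw [← map_list_prod, hk.2.2]
  have hlen (k : List W) (hk : k ∈ RedT cs w) : (k.map (MulAut.conj u⁻¹)).length ≤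
      Module.finrank ℝ (cs.movedSpace (l.map (MulAut.conj u⁻¹)).prod) := by
    rw [hprod l hl, List.length_map]
    exact CoxeterSystem.length_le_finrank_movedSpace_conj hk u⁻¹
  rw [hinv, ← CoxeterSystem.closure_map_conj]
  refine CoxeterSystem.standardParabolic_eq_of_length_le
    (CoxeterSystem.forall_isReflection_map_conj hl.2.1 u⁻¹)
    (CoxeterSystem.forall_isReflection_map_conj hl'.2.1 u⁻¹) (by rw [hprod l hl, hprod l' hl'])
    (hlen l hl) (hlen l' hl') ?_
  rw [CoxeterSystem.closure_map_conj, hgen, hinv]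
  rfl
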